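/- arXiv:1801.04583 — 7 statements merged into one kernel-verified Lean document; each statement's English description precedes it below -/
import Mathlib

section
/- Let X be a complete CAT(0) space and let {Y_a}_{a∈I} be an arbitrary (possibly infinite) collection of closed bounded convex subsets of X. If every finite subfamily Y_{a₁}, …, Y_{a_n} has nonempty intersection, then the intersection of the whole family ⋂_{a∈I} Y_a is nonempty. -/
open Metric Filter

/-- A geodesic (parametrized on `[0,1]`) in a metric space. -/
def IsGeodesic {X : Type*} [MetricSpace X] (γ : ℝ → X) : Prop :=
  ∀ s ∈ Set.Icc (0:ℝ) 1, ∀ t ∈ Set.Icc (0:ℝ) 1,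
    dist (γ s) (γ t) = |s - t| * dist (γ 0) (γ 1)

/-- A geodesic metric space: any two points are joined by a geodesic. -/
def GeodesicMetricSpace (X : Type*) [MetricSpace X] : Prop :=
  ∀ x y : X, ∃ γ : ℝ → X, IsGeodesic γ ∧ γ 0 = x ∧ γ 1 = y

/-- CAT(0): geodesic space in which squared distance functions are 2-convex. -/
def Cat0 (X : Type*) [MetricSpace X] : Prop :=
  GeodesicMetricSpace X ∧
  ∀ (y : X) (γ : ℝ → X), IsGeodesic γ → ∀ t ∈ Set.Icc (0:ℝ) 1,
    dist y (γ t) ^ 2 ≤ (1 - t) * dist y (γ 0) ^ 2 + t * dist y (γ 1) ^ 2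
      - t * (1 - t) * dist (γ 0) (γ 1) ^ 2

/-- A geodesically convex subset. -/
def GeoConvex {X : Type*} [MetricSpace X] (Y : Set X) : Prop :=
  ∀ γ : ℝ → X, IsGeodesic γ → γ 0 ∈ Y → γ 1 ∈ Y → ∀ t ∈ Set.Icc (0:ℝ) 1, γ t ∈ Y

/-- A `λ`-convex function on a metric space. -/
def LambdaConvex {X : Type*} [MetricSpace X] (lam : ℝ) (F : X → ℝ) : Prop :=
  ∀ γ : ℝ → X, IsGeodesic γ → ∀ t ∈ Set.Icc (0:ℝ) 1,
    F (γ t) ≤ (1 - t) * F (γ 0) + t * F (γ 1)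
      - t * (1 - t) * (lam / 2) * dist (γ 0) (γ 1) ^ 2

/-- Locally Lipschitz on a subset. -/
def LocLipschitzOn {X Y : Type*} [MetricSpace X] [MetricSpace Y] (f : X → Y) (D : Set X) : Prop :=
  ∀ t ∈ D, ∃ K : NNReal, ∃ ε > 0, LipschitzOnWith K f (D ∩ Metric.ball t ε)

/-- The (downward) absolute gradient `|∇₋F|(x)`. -/
noncomputable def absGradient {X : Type*} [MetricSpace X] (F : X → ℝ) (x : X) : ℝ :=
  max (Filter.limsup (fun y => (F x - F y) / dist x y) (nhdsWithin x {x}ᶜ)) 0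

/-- `m` is a gradient curve of `F` at time `t`. -/
def IsGradientCurveAt {X : Type*} [MetricSpace X] (F : X → ℝ) (m : ℝ → X) (t : ℝ) : Prop :=
  Filter.Tendsto (fun ε : ℝ => dist (m (t + ε)) (m t) / ε) (nhdsWithin 0 (Set.Ioi 0))
    (nhds (absGradient F (m t))) ∧
  Filter.Tendsto (fun ε : ℝ => (F (m (t + ε)) - F (m t)) / ε) (nhdsWithin 0 (Set.Ioi 0))
    (nhds (-(absGradient F (m t)) ^ 2))


/-- Arbitrary intersections of geodesically convex sets are geodesically convex. -/
theorem GeoConvex.biInter {X ι : Type*} [MetricSpace X] {Y : ι → Set X}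
    (hconv : ∀ a, GeoConvex (Y a)) (s : Set ι) : GeoConvex (⋂ a ∈ s, Y a) := by
  intro γ hγ h0 h1 t ht
  simp only [Set.mem_iInter] at h0 h1 ⊢
  exact fun a ha => hconv a γ hγ (h0 a ha) (h1 a ha) t ht

/-- In a CAT(0) space, two points of a convex set `C` lying within distance `r` of `p` are close
to each other when `r` is close to the distance from `p` to `C`. -/
theorem Cat0.sq_dist_le {X : Type*} [MetricSpace X] (hX : Cat0 X) {C : Set X} (hC : GeoConvex C)
    {p x y : X} {r : ℝ} (hx : x ∈ C) (hy : y ∈ C) (hxr : dist p x ≤ r) (hyr : dist p y ≤ r) :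
    dist x y ^ 2 ≤ 4 * (r ^ 2 - infDist p C ^ 2) := by
  obtain ⟨γ, hγ, rfl, rfl⟩ := hX.1 x y
  have hhalf : (1 / 2 : ℝ) ∈ Set.Icc (0 : ℝ) 1 := by norm_num
  have hmid := hX.2 p γ hγ (1 / 2) hhalf
  have hinf : infDist p C ^ 2 ≤ dist p (γ (1 / 2)) ^ 2 :=
    pow_le_pow_left₀ infDist_nonneg (infDist_le_dist_of_mem (hC γ hγ hx hy _ hhalf)) 2
  have hx2 : dist p (γ 0) ^ 2 ≤ r ^ 2 := pow_le_pow_left₀ dist_nonneg hxr 2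
  have hy2 : dist p (γ 1) ^ 2 ≤ r ^ 2 := pow_le_pow_left₀ dist_nonneg hyr 2
  linarith

theorem stmt1 {X : Type*} [MetricSpace X] [CompleteSpace X] (hX : Cat0 X)
    {ι : Type*} (Y : ι → Set X)
    (hclosed : ∀ a, IsClosed (Y a)) (hbdd : ∀ a, Bornology.IsBounded (Y a))
    (hconv : ∀ a, GeoConvex (Y a))
    (hfin : ∀ s : Finset ι, (⋂ a ∈ s, Y a).Nonempty) :
    (⋂ a, Y a).Nonempty := by
  classical
  rcases isEmpty_or_nonempty ι with hι | ⟨⟨a₀⟩⟩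
  · simpa using hfin ∅
  obtain ⟨p, -⟩ := hfin ∅
  set C : Finset ι → Set X := fun s => ⋂ a ∈ s, Y a
  have hCanti : ∀ {s t : Finset ι}, s ⊆ t → C t ⊆ C s := fun h =>
    Set.biInter_subset_biInter_left h
  have hCconv : ∀ s, GeoConvex (C s) := fun s => GeoConvex.biInter hconv (s : Set ι)
  obtain ⟨R, hR⟩ := (hbdd a₀).subset_closedBall p
  have hbound : BddAbove (Set.range fun s => infDist p (C s)) := by
    refine ⟨R, ?_⟩
    rintro _ ⟨s, rfl⟩
    obtain ⟨y, hy⟩ := hfin (insert a₀ s)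
    have hy₀ : y ∈ Y a₀ := Set.mem_iInter₂.1 hy a₀ (Finset.mem_insert_self a₀ s)
    have hyR : dist p y ≤ R := by simpa [dist_comm] using hR hy₀
    exact (infDist_le_dist_of_mem (hCanti (Finset.subset_insert a₀ s) hy)).trans hyR
  set D : ℝ := ⨆ s, infDist p (C s)
  have hdD : ∀ s, infDist p (C s) ≤ D := fun s => le_ciSup hbound s
  have hD0 : 0 ≤ D := infDist_nonneg.trans (hdD ∅)
  have hpick : ∀ q : Finset ι × ℕ, ∃ x ∈ C q.1, dist p x < D + 1 / ((q.2 : ℝ) + 1) := fun q =>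
    (infDist_lt_iff (hfin q.1)).1 ((hdD q.1).trans_lt (lt_add_of_pos_right D (by positivity)))
  choose x hxC hxD using hpick
  have hcauchy : CauchySeq x := by
    refine Metric.cauchySeq_iff.2 fun ε hε => ?_
    obtain ⟨n, hn⟩ := exists_nat_one_div_lt
      (show 0 < min 1 (ε ^ 2 / (16 * D + 4)) by positivity)
    set δ : ℝ := 1 / ((n : ℝ) + 1)
    have hδ0 : 0 < δ := by positivity
    obtain ⟨hδ1, hδε⟩ := lt_min_iff.1 hn
    rw [lt_div_iff₀ (by positivity)] at hδε
    obtain ⟨s, hs⟩ := exists_lt_of_lt_ciSup (sub_lt_self D hδ0)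
    have hmem : ∀ q ≥ (s, n), x q ∈ C s ∧ dist p (x q) ≤ D + δ := fun q hq =>
      ⟨hCanti hq.1 (hxC q), (hxD q).le.trans
        (add_le_add_right (Nat.one_div_le_one_div hq.2) D)⟩
    refine ⟨(s, n), fun q hq q' hq' => lt_of_pow_lt_pow_left₀ 2 hε.le ?_⟩
    have hdist := hX.sq_dist_le (hCconv s) (hmem q hq).1 (hmem q' hq').1
      (hmem q hq).2 (hmem q' hq').2
    have hgap : D ^ 2 - infDist p (C s) ^ 2 ≤ δ * (2 * D) := by
      have hprod : (D - infDist p (C s)) * (D + infDist p (C s)) ≤ δ * (2 * D) :=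
        mul_le_mul (by linarith) (by linarith [hdD s])
          (add_nonneg hD0 infDist_nonneg) hδ0.le
      linarith
    nlinarith
  obtain ⟨z, hz⟩ := cauchySeq_tendsto_of_complete hcauchy
  refine ⟨z, Set.mem_iInter.2 fun a => (hclosed a).mem_of_tendsto hz ?_⟩
  filter_upwards [eventually_ge_atTop (({a} : Finset ι), 0)] with q hq
  exact Set.mem_iInter₂.1 (hxC q) a (hq.1 (Finset.mem_singleton_self a))
end

section
/- Let X be a complete CAT(0) space and let F : X → ℝ be convex (i.e. 0-convex along geodesics) and lower semicontinuous. Then F is bounded from below on every bounded subset of X, and F attains its infimum on every nonempty bounded closed convex subset of X. -/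
open Metric Filter

/-- Closed balls of a CAT(0) space are geodesically convex. -/
theorem Cat0.geoConvex_closedBall {X : Type*} [MetricSpace X] (hX : Cat0 X) (p : X) (R : ℝ) :
    GeoConvex (closedBall p R) := by
  intro γ hγ h0 h1 t ht
  have hc := hX.2 p γ hγ t ht
  rw [mem_closedBall'] at *
  have hR : 0 ≤ R := dist_nonneg.trans h0
  have e0 : dist p (γ 0) ^ 2 ≤ R ^ 2 := by gcongr
  have e1 : dist p (γ 1) ^ 2 ≤ R ^ 2 := by gcongr
  have ht1 : 0 ≤ 1 - t := sub_nonneg.2 ht.2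
  refine (abs_le_of_sq_le_sq' ?_ hR).2
  have i0 := mul_le_mul_of_nonneg_left e0 ht1
  have i1 := mul_le_mul_of_nonneg_left e1 ht.1
  have i2 : 0 ≤ t * (1 - t) * dist (γ 0) (γ 1) ^ 2 :=
    mul_nonneg (mul_nonneg ht.1 ht1) (sq_nonneg _)
  linarith

/-- The part of a convex set lying in a sublevel set of a convex function is convex. -/
theorem GeoConvex.inter_sublevel {X : Type*} [MetricSpace X] {Y : Set X} (hY : GeoConvex Y)
    {F : X → ℝ} (hF : LambdaConvex 0 F) (a : ℝ) : GeoConvex (Y ∩ F ⁻¹' Set.Iic a) := by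
  intro γ hγ h0 h1 t ht
  refine ⟨hY γ hγ h0.1 h1.1 t ht, ?_⟩
  have hc := hF γ hγ t ht
  have e0 : F (γ 0) ≤ a := h0.2
  have e1 : F (γ 1) ≤ a := h1.2
  have i0 := mul_le_mul_of_nonneg_left e0 (sub_nonneg.2 ht.2)
  have i1 := mul_le_mul_of_nonneg_left e1 ht.1
  change F (γ t) ≤ a
  linarith

/-- Two points of a convex set which are almost nearest to `p` are close to each other. -/
theorem Cat0.dist_sq_le_of_geoConvex {X : Type*} [MetricSpace X] (hX : Cat0 X) {C : Set X}
    (hC : GeoConvex C) (p : X) {x y : X} (hx : x ∈ C) (hy : y ∈ C) :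
    dist x y ^ 2 ≤ 2 * dist p x ^ 2 + 2 * dist p y ^ 2 - 4 * infDist p C ^ 2 := by
  obtain ⟨γ, hγ, rfl, rfl⟩ := hX.1 x y
  have ht : (1 / 2 : ℝ) ∈ Set.Icc (0 : ℝ) 1 := by norm_num
  have hc := hX.2 p γ hγ _ ht
  have hm : infDist p C ^ 2 ≤ dist p (γ (1 / 2)) ^ 2 :=
    pow_le_pow_left₀ infDist_nonneg (infDist_le_dist_of_mem (hC γ hγ hx hy _ ht)) 2
  linarith

/-- Cantor's intersection theorem for bounded closed convex subsets of a complete CAT(0) space. -/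
theorem Cat0.nonempty_iInter {X : Type*} [MetricSpace X] [CompleteSpace X] (hX : Cat0 X)
    {C : ℕ → Set X} (hanti : Antitone C) (hne : ∀ n, (C n).Nonempty)
    (hbdd : Bornology.IsBounded (C 0)) (hclosed : ∀ n, IsClosed (C n))
    (hconv : ∀ n, GeoConvex (C n)) : (⋂ n, C n).Nonempty := by
  obtain ⟨p, hp⟩ := hne 0
  set q : ℕ → ℝ := fun n => infDist p (C n) ^ 2
  have hmono : Monotone q := fun m n hmn =>
    pow_le_pow_left₀ infDist_nonneg (infDist_le_infDist_of_subset (hanti hmn) (hne n)) 2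
  have hqb : BddAbove (Set.range q) := by
    refine ⟨diam (C 0) ^ 2, ?_⟩
    rintro _ ⟨n, rfl⟩
    obtain ⟨y, hy⟩ := hne n
    exact pow_le_pow_left₀ infDist_nonneg ((infDist_le_dist_of_mem hy).trans
      (dist_le_diam_of_mem hbdd hp (hanti (Nat.zero_le n) hy))) 2
  have hlim := tendsto_atTop_ciSup hmono hqb
  have hex : ∀ n : ℕ, ∃ x ∈ C n, dist p x ^ 2 ≤ q n + 1 / ((n : ℝ) + 1) := by
    intro n
    have hpos : (0 : ℝ) < 1 / ((n : ℝ) + 1) := Nat.one_div_pos_of_nat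
    have hlt : infDist p (C n) < √(q n + 1 / ((n : ℝ) + 1)) :=
      Real.lt_sqrt_of_sq_lt (lt_add_of_pos_right _ hpos)
    obtain ⟨x, hx, hpx⟩ := (infDist_lt_iff (hne n)).1 hlt
    exact ⟨x, hx, ((Real.lt_sqrt dist_nonneg).1 hpx).le⟩
  choose x hxC hx using hex
  have hcau : CauchySeq x := by
    refine cauchySeq_of_le_tendsto_0'
      (fun n => √(2 * ((⨆ k, q k) - q n) + 4 * (1 / ((n : ℝ) + 1)))) (fun n m hnm => ?_) ?_
    · refine Real.le_sqrt_of_sq_le ?_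
      have h1 := hX.dist_sq_le_of_geoConvex (hconv n) p (hxC n) (hanti hnm (hxC m))
      have h2 : q m ≤ ⨆ k, q k := le_ciSup hqb m
      have h3 : 1 / ((m : ℝ) + 1) ≤ 1 / ((n : ℝ) + 1) := Nat.one_div_le_one_div hnm
      have h4 := hx n
      have h5 := hx m
      change _ ≤ _ - 4 * q n at h1
      linarith
    · have h := (((tendsto_const_nhds (x := ⨆ k, q k)).sub hlim).const_mul 2).add
        ((tendsto_one_div_add_atTop_nhds_zero_nat (𝕜 := ℝ)).const_mul 4)
      simpa using h.sqrt
  obtain ⟨z, hz⟩ := cauchySeq_tendsto_of_complete hcau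
  refine ⟨z, Set.mem_iInter.2 fun n => (hclosed n).mem_of_tendsto hz ?_⟩
  filter_upwards [eventually_ge_atTop n] with m hm using hanti hm (hxC m)

/-- If a convex lower semicontinuous function comes below each term of an antitone sequence on a
bounded closed convex set, then it is below all terms at a single point. -/
theorem Cat0.exists_forall_le_of_antitone {X : Type*} [MetricSpace X] [CompleteSpace X]
    (hX : Cat0 X) {F : X → ℝ} (hF : LambdaConvex 0 F) (hlsc : LowerSemicontinuous F)
    {Y : Set X} (hbdd : Bornology.IsBounded Y) (hclosed : IsClosed Y) (hY : GeoConvex Y)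
    {a : ℕ → ℝ} (ha : Antitone a) (h : ∀ n, ∃ y ∈ Y, F y ≤ a n) :
    ∃ x ∈ Y, ∀ n, F x ≤ a n := by
  obtain ⟨x, hx⟩ := hX.nonempty_iInter (C := fun n => Y ∩ F ⁻¹' Set.Iic (a n))
    (fun m n hmn => Set.inter_subset_inter_right _
      (Set.preimage_mono (Set.Iic_subset_Iic.2 (ha hmn))))
    h (hbdd.subset Set.inter_subset_left)
    (fun n => hclosed.inter (hlsc.isClosed_preimage (a n)))
    (fun n => hY.inter_sublevel hF (a n))
  rw [Set.mem_iInter] at hx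
  exact ⟨x, (hx 0).1, fun n => (hx n).2⟩

/-- A convex lower semicontinuous function is bounded below on bounded closed convex sets. -/
theorem Cat0.bddBelow_image {X : Type*} [MetricSpace X] [CompleteSpace X]
    (hX : Cat0 X) {F : X → ℝ} (hF : LambdaConvex 0 F) (hlsc : LowerSemicontinuous F)
    {Y : Set X} (hbdd : Bornology.IsBounded Y) (hclosed : IsClosed Y) (hY : GeoConvex Y) :
    BddBelow (F '' Y) := by
  by_contra hb
  rw [not_bddBelow_iff] at hb
  obtain ⟨x, -, hx⟩ := hX.exists_forall_le_of_antitone hF hlsc hbdd hclosed hY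
    (a := fun n => -(n : ℝ)) (fun m n hmn => neg_le_neg (Nat.cast_le.2 hmn)) (fun n => by
      obtain ⟨_, ⟨y, hy, rfl⟩, hlt⟩ := hb (-(n : ℝ))
      exact ⟨y, hy, hlt.le⟩)
  obtain ⟨n, hn⟩ := exists_nat_gt (-F x)
  linarith [hx n]

theorem stmt2 {X : Type*} [MetricSpace X] [CompleteSpace X] (hX : Cat0 X)
    (F : X → ℝ) (hconv : LambdaConvex 0 F) (hlsc : LowerSemicontinuous F) :
    (∀ S : Set X, Bornology.IsBounded S → BddBelow (F '' S)) ∧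
    (∀ Y : Set X, Y.Nonempty → Bornology.IsBounded Y → IsClosed Y → GeoConvex Y →
      ∃ x ∈ Y, ∀ y ∈ Y, F x ≤ F y) := by
  constructor
  · intro S hS
    rcases S.eq_empty_or_nonempty with rfl | ⟨p, -⟩
    · simp
    obtain ⟨R, hR⟩ := hS.subset_closedBall p
    exact (hX.bddBelow_image hconv hlsc isBounded_closedBall isClosed_closedBall
      (hX.geoConvex_closedBall p R)).mono (Set.image_mono hR)
  · intro Y hne hbdd hclosed hY
    have hb := hX.bddBelow_image hconv hlsc hbdd hclosed hY
    obtain ⟨x, hxY, hx⟩ := hX.exists_forall_le_of_antitone hconv hlsc hbdd hclosed hY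
      (a := fun n => sInf (F '' Y) + 1 / ((n : ℝ) + 1))
      (fun m n hmn => add_le_add_right (Nat.one_div_le_one_div hmn) _) (fun n => by
        obtain ⟨_, ⟨y, hy, rfl⟩, hlt⟩ := exists_lt_of_csInf_lt (hne.image F)
          (lt_add_of_pos_right _ (Nat.one_div_pos_of_nat (α := ℝ) (n := n)))
        exact ⟨y, hy, hlt.le⟩)
    have hlim := (tendsto_one_div_add_atTop_nhds_zero_nat (𝕜 := ℝ)).const_add (sInf (F '' Y))
    rw [add_zero] at hlim
    have hle : F x ≤ sInf (F '' Y) := ge_of_tendsto' hlim hx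
    exact ⟨x, hxY, fun y hy => hle.trans (csInf_le hb (Set.mem_image_of_mem F hy))⟩
end

section
/- Let X be a complete CAT(0) space and let F : X → ℝ be λ-convex and locally Lipschitz. Let h > 0, and if λ < 0 assume in addition that h < −1/(2λ). Then for every x₀ ∈ X the step-energy function E(x) := F(x) + d(x₀,x)²/(2h) has a unique minimum point on X. -/
open Metric Filter

/-- In a CAT(0) space, adding `dist x₀ · ^ 2 / (2 * h)` raises the convexity constant by `1 / h`. -/
theorem LambdaConvex.add_sq_dist_div {X : Type*} [MetricSpace X] (hX : Cat0 X) {lam : ℝ}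
    {F : X → ℝ} (hF : LambdaConvex lam F) {h : ℝ} (hh : 0 < h) (x₀ : X) :
    LambdaConvex (lam + 1 / h) (fun x => F x + dist x₀ x ^ 2 / (2 * h)) := by
  intro γ hγ t ht
  have h1 := hF γ hγ t ht
  have h2 := div_le_div_of_nonneg_right (hX.2 x₀ γ hγ t ht) (by positivity : 0 ≤ 2 * h)
  refine (add_le_add h1 h2).trans (le_of_eq ?_)
  field_simp
  ring

/-- A continuous strongly convex function on a geodesic space is bounded below. -/
theorem LambdaConvex.bddBelow_range {X : Type*} [MetricSpace X] (hX : GeodesicMetricSpace X)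
    {k : ℝ} (hk : 0 < k) {E : X → ℝ} (hE : LambdaConvex k E) (hc : Continuous E) :
    BddBelow (Set.range E) := by
  rcases isEmpty_or_nonempty X with hemp | ⟨⟨x⟩⟩
  · simp [Set.range_eq_empty]
  obtain ⟨r, hr, hball⟩ := Metric.continuousAt_iff.1 (hc.continuousAt (x := x)) 1 one_pos
  have hnear : ∀ y, dist y x < r → E x - 1 < E y := fun y hy => by
    have := (abs_lt.1 (hball hy)).1
    linarith
  refine ⟨E x - 1 - 4 / (k * r ^ 2), ?_⟩
  rintro _ ⟨w, rfl⟩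
  have hpos : 0 < 4 / (k * r ^ 2) := by positivity
  rcases lt_or_ge (dist w x) r with hw | hw
  · linarith [hnear w hw]
  obtain ⟨γ, hγ, rfl, rfl⟩ := hX x w
  rw [dist_comm] at hw
  set D := dist (γ 0) (γ 1) with hD
  have hDpos : 0 < D := hr.trans_le hw
  obtain ⟨t, htD⟩ : ∃ t, t * D = r / 2 := ⟨r / 2 / D, by field_simp⟩
  have ht0 : 0 < t := by
    by_contra! ht
    nlinarith
  have ht1 : t ≤ 1 / 2 := by
    by_contra! ht
    nlinarith
  have htI : t ∈ Set.Icc (0 : ℝ) 1 := ⟨ht0.le, by linarith⟩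
  have hdist : dist (γ t) (γ 0) = t * D := by
    rw [hγ t htI 0 (by simp), sub_zero, abs_of_pos ht0]
  have h1 := hnear (γ t) (by rw [hdist]; linarith)
  have h2 := hE γ hγ t htI
  rw [← hD] at h2
  have h3 : k / 4 * (t * D ^ 2) ≤ t * (1 - t) * (k / 2) * D ^ 2 := by
    have : 0 ≤ t * k * D ^ 2 * (1 / 2 - t) :=
      mul_nonneg (by positivity) (by linarith)
    nlinarith
  have h4 : 1 ≤ t * (4 / (k * r ^ 2) + k / 4 * D ^ 2) := by
    have hsq : t * (4 / (k * r ^ 2) + k / 4 * D ^ 2) =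
        t * k / 4 * (D - 4 / (k * r)) ^ 2 + 2 * (t * D) / r := by
      field_simp
      ring
    have hone : 2 * (t * D) / r = 1 := by
      rw [htD]
      field_simp
    have : 0 ≤ t * k / 4 * (D - 4 / (k * r)) ^ 2 := by positivity
    linarith
  have h5 : t * (E (γ 0) - 1 - 4 / (k * r ^ 2)) ≤ t * E (γ 1) := by
    nlinarith
  exact le_of_mul_le_mul_left h5 ht0

/-- If `m` bounds a strongly convex function from below, points with almost minimal values are
close to each other. -/
theorem LambdaConvex.sq_dist_le {X : Type*} [MetricSpace X] (hX : GeodesicMetricSpace X)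
    {k : ℝ} (hk : 0 < k) {E : X → ℝ} (hE : LambdaConvex k E) {m b : ℝ} (hm : ∀ x, m ≤ E x)
    {x y : X} (hx : E x ≤ m + b) (hy : E y ≤ m + b) : dist x y ^ 2 ≤ 8 / k * b := by
  obtain ⟨γ, hγ, rfl, rfl⟩ := hX x y
  have h1 := hE γ hγ (1 / 2) (by constructor <;> norm_num)
  have h2 := hm (γ (1 / 2))
  rw [div_mul_eq_mul_div, le_div_iff₀ hk]
  linarith

/-- A continuous strongly convex function on a complete geodesic space has a unique minimizer. -/
theorem LambdaConvex.existsUnique_forall_le {X : Type*} [MetricSpace X] [CompleteSpace X]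
    [Nonempty X] (hX : GeodesicMetricSpace X) {k : ℝ} (hk : 0 < k) {E : X → ℝ}
    (hE : LambdaConvex k E) (hc : Continuous E) : ∃! z : X, ∀ w : X, E z ≤ E w := by
  have hbdd := hE.bddBelow_range hX hk hc
  have hm : ∀ x, (⨅ y, E y) ≤ E x := fun x => ciInf_le hbdd x
  have hlt : ∀ n : ℕ, ∃ x, E x < (⨅ y, E y) + 1 / ((n : ℝ) + 1) := fun n =>
    exists_lt_of_ciInf_lt (lt_add_of_pos_right _ Nat.one_div_pos_of_nat)
  choose u hu using hlt
  have hlim := tendsto_one_div_add_atTop_nhds_zero_nat (𝕜 := ℝ)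
  have hcauchy : CauchySeq u := by
    refine cauchySeq_of_le_tendsto_0 (fun n : ℕ => √(8 / k * (1 / ((n : ℝ) + 1)))) ?_ ?_
    · intro n p N hn hp
      refine Real.le_sqrt_of_sq_le (hE.sq_dist_le hX hk hm ?_ ?_)
      · exact (hu n).le.trans (by gcongr)
      · exact (hu p).le.trans (by gcongr)
    · simpa using (hlim.const_mul (8 / k)).sqrt
  obtain ⟨z, hz⟩ := cauchySeq_tendsto_of_complete hcauchy
  have hEz : E z ≤ ⨅ y, E y := by
    refine le_of_tendsto_of_tendsto' ((hc.tendsto z).comp hz) ?_ fun n => (hu n).le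
    simpa using hlim.const_add (⨅ y, E y)
  refine ⟨z, fun w => hEz.trans (hm w), fun y hy => ?_⟩
  have h1 := hE.sq_dist_le hX hk hm (b := 0) (x := y) (y := z)
    (by linarith [hy z]) (by linarith)
  rw [mul_zero] at h1
  exact dist_eq_zero.1 (pow_eq_zero_iff two_ne_zero |>.1 (le_antisymm h1 (sq_nonneg _)))

theorem stmt3 {X : Type*} [MetricSpace X] [CompleteSpace X] (hX : Cat0 X)
    (lam : ℝ) (F : X → ℝ) (hconv : LambdaConvex lam F) (hlip : LocallyLipschitz F)
    (h : ℝ) (hh : 0 < h) (hlam : lam < 0 → h < -1 / (2 * lam)) (x₀ : X) :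
    ∃! z : X, ∀ w : X,
      F z + dist x₀ z ^ 2 / (2 * h) ≤ F w + dist x₀ w ^ 2 / (2 * h) := by
  have hk : 0 < lam + 1 / h := by
    have hpos : 0 < 1 / h := by positivity
    rcases lt_or_ge lam 0 with hl | hl
    · have h1 := hlam hl
      rw [lt_div_iff_of_neg (by linarith)] at h1
      have h2 : lam + 1 / h = (lam * h + 1) / h := by field_simp
      rw [h2]
      exact div_pos (by nlinarith) hh
    · linarith
  have : Nonempty X := ⟨x₀⟩
  have hc : Continuous (fun x => F x + dist x₀ x ^ 2 / (2 * h)) := by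
    have := hlip.continuous
    fun_prop
  exact (hconv.add_sq_dist_div hX hh x₀).existsUnique_forall_le hX.1 hk hc
end

section
/- Let X be a complete CAT(0) space and let F : X → ℝ be λ-convex and locally Lipschitz. Let h > 0, and if λ < 0 assume in addition that h < −1/(2λ). For x ∈ X let J(x,h) denote the unique minimum point of z ↦ F(z) + d(x,z)²/(2h). Then the discrete flow map x ↦ J(x,h) is (1+λh)⁻¹-Lipschitz: for all x, y ∈ X, d(J(x,h), J(y,h)) ≤ (1+λh)⁻¹ · d(x,y). -/
open Metric Filter

/-- Reshetnyak's quadrilateral inequality in a CAT(0) space. -/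
theorem Cat0.quadrilateral {X : Type*} [MetricSpace X] (hX : Cat0 X) (x y a b : X) :
    dist x b ^ 2 + dist y a ^ 2 ≤ dist x a ^ 2 + dist y b ^ 2 + 2 * dist x y * dist a b := by
  rcases eq_or_ne x y with rfl | hxy
  · simp [add_comm]
  rcases eq_or_ne a b with rfl | hab
  · simp
  have hp : 0 < dist x y := dist_pos.2 hxy
  have hq : 0 < dist a b := dist_pos.2 hab
  obtain ⟨γ, hγ, h0, h1⟩ := hX.1 x b
  set p := dist x y with hp_def
  set q := dist a b with hq_def
  have ht : p / (p + q) ∈ Set.Icc (0 : ℝ) 1 :=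
    ⟨by positivity, (div_le_one (by positivity)).2 (by linarith)⟩
  have ha := hX.2 a γ hγ _ ht
  have hy := hX.2 y γ hγ _ ht
  set z := γ (p / (p + q))
  rw [h0, h1, dist_comm a x, ← hq_def] at ha
  rw [h0, h1, dist_comm y x, ← hp_def] at hy
  have htri : dist y a ≤ dist y z + dist a z := dist_triangle_right y a z
  have hs : 1 - p / (p + q) = q / (p + q) := by field_simp; ring
  rw [hs] at ha hy
  have hsq : p * q * dist y a ^ 2 ≤
      (p + q) * (p * dist a z ^ 2 + q * dist y z ^ 2) := by
    have h2 : dist y a ^ 2 ≤ (dist y z + dist a z) ^ 2 := by gcongr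
    have h3 := mul_le_mul_of_nonneg_left h2 (mul_pos hp hq).le
    nlinarith [sq_nonneg (p * dist a z - q * dist y z)]
  have hsum := mul_le_mul_of_nonneg_left
    (add_le_add (mul_le_mul_of_nonneg_left ha hp.le) (mul_le_mul_of_nonneg_left hy hq.le))
    (add_pos hp hq).le
  have hid : (p + q) * (p * (q / (p + q) * dist x a ^ 2 + p / (p + q) * q ^ 2
        - p / (p + q) * (q / (p + q)) * dist x b ^ 2)
      + q * (q / (p + q) * p ^ 2 + p / (p + q) * dist y b ^ 2
        - p / (p + q) * (q / (p + q)) * dist x b ^ 2))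
      = p * q * (dist x a ^ 2 + dist y b ^ 2 + 2 * p * q - dist x b ^ 2) := by
    field_simp
    ring
  have := le_of_mul_le_mul_left ((hsq.trans hsum).trans_eq hid) (mul_pos hp hq)
  linarith

/-- A `μ`-convex function grows at least quadratically away from a minimum point. -/
theorem LambdaConvex.quadratic_growth {X : Type*} [MetricSpace X]
    (hX : GeodesicMetricSpace X) {μ : ℝ} {f : X → ℝ} (hf : LambdaConvex μ f) {a : X}
    (ha : ∀ w, f a ≤ f w) (b : X) : f a + μ / 2 * dist a b ^ 2 ≤ f b := by
  obtain ⟨γ, hγ, h0, h1⟩ := hX a b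
  by_contra! hlt
  have hB := ha b
  have hA : 0 < μ / 2 * dist a b ^ 2 := by linarith
  set A := μ / 2 * dist a b ^ 2 with hA_def
  set t := (A - (f b - f a)) / (2 * A) with ht_def
  have ht0 : 0 < t := div_pos (by linarith) (by linarith)
  have ht1 : t ≤ 1 := (div_le_one (by linarith)).2 (by linarith)
  have htA : t * A = (A - (f b - f a)) / 2 := by rw [ht_def]; field_simp
  have hc := hf γ hγ t ⟨ht0.le, ht1⟩
  rw [h0, h1] at hc
  have hm := ha (γ t)
  have : t * ((1 - t) * A) ≤ t * (f b - f a) := by rw [hA_def]; linarith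
  have := le_of_mul_le_mul_left this ht0
  linarith

/-- In a CAT(0) space, the step energy of a `lam`-convex function is `(lam + 1 / h)`-convex. -/
theorem LambdaConvex.stepEnergy {X : Type*} [MetricSpace X] (hX : Cat0 X) {lam : ℝ} {F : X → ℝ}
    (hF : LambdaConvex lam F) {h : ℝ} (hh : 0 < h) (x : X) :
    LambdaConvex (lam + 1 / h) fun w => F w + dist x w ^ 2 / (2 * h) := by
  intro γ hγ t ht
  have hd := div_le_div_of_nonneg_right (hX.2 x γ hγ t ht) (mul_pos two_pos hh).le
  refine (add_le_add (hF γ hγ t ht) hd).trans_eq ?_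
  field_simp
  ring

theorem stmt4 {X : Type*} [MetricSpace X] [CompleteSpace X] (hX : Cat0 X)
    (lam : ℝ) (F : X → ℝ) (hconv : LambdaConvex lam F) (hlip : LocallyLipschitz F)
    (h : ℝ) (hh : 0 < h) (hlam : lam < 0 → h < -1 / (2 * lam))
    (x y jx jy : X)
    (hjx : ∀ w : X, F jx + dist x jx ^ 2 / (2 * h) ≤ F w + dist x w ^ 2 / (2 * h))
    (hjy : ∀ w : X, F jy + dist y jy ^ 2 / (2 * h) ≤ F w + dist y w ^ 2 / (2 * h)) :
    dist jx jy ≤ (1 + lam * h)⁻¹ * dist x y := by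
  have hpos : 0 < 1 + lam * h := by
    rcases lt_or_ge lam 0 with hl | hl
    · have := (lt_div_iff_of_neg (by linarith)).1 (hlam hl)
      linarith
    · positivity
  rcases eq_or_ne jx jy with rfl | hne
  · simpa using mul_nonneg (inv_nonneg.2 hpos.le) dist_nonneg
  have hD : 0 < dist jx jy := dist_pos.2 hne
  have h1 := (hconv.stepEnergy hX hh x).quadratic_growth hX.1 hjx jy
  have h2 := (hconv.stepEnergy hX hh y).quadratic_growth hX.1 hjy jx
  have h3 := hX.quadrilateral x y jx jy
  rw [dist_comm jy jx] at h2
  have h4 := mul_le_mul_of_nonneg_left (add_le_add h1 h2) (mul_pos two_pos hh).le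
  field_simp at h4
  rw [inv_mul_eq_div, le_div_iff₀ hpos]
  refine le_of_mul_le_mul_right ?_ hD
  linarith
end

section
/- Let X be a complete CAT(0) space, let F : X → ℝ be λ-convex and locally Lipschitz, and fix y ∈ X and A ≥ 0 such that for every ε > 0 there exists R > 0 with F(x) ≥ −(A+ε)·d(x,y)² whenever d(x,y) ≥ R. Set D = [0,∞) if A = 0 and D = [0, 1/(16A)] if A > 0. Then for every x₀ ∈ X there exists a unique locally Lipschitz curve m : D → X with m(0) = x₀ which is a gradient curve of F at every t ∈ D with t < sup D; moreover F(m(t)) ≤ F(x₀) for all t ∈ D. -/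
open Metric Filter

/-- The domain of the gradient curve: `[0,∞)` if `A = 0`, `[0, 1/(16A)]` if `A > 0`. -/
noncomputable def GradDomain (A : ℝ) : Set ℝ :=
  if A = 0 then Set.Ici 0 else Set.Icc 0 (1 / (16 * A))

/-- `m` is a locally Lipschitz gradient curve of `F` starting at `x₀`,
defined on `GradDomain A`, which is a gradient curve at every `t ∈ GradDomain A`
with `t < sup (GradDomain A)`. -/
def IsGradSolution {X : Type*} [MetricSpace X] (F : X → ℝ) (A : ℝ) (x₀ : X)
    (m : ℝ → X) : Prop :=
  m 0 = x₀ ∧ LocLipschitzOn m (GradDomain A) ∧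
  ∀ t ∈ GradDomain A, (A = 0 ∨ t < 1 / (16 * A)) → IsGradientCurveAt F m t

section Prox

variable {X : Type*} [MetricSpace X]

/-- `x'` is a proximal point of `x` for the step size `τ`, expressed by the variational
inequality that minimality yields for a `-Λ`-convex function on a CAT(0) space. -/
def IsProx (F : X → ℝ) (Λ τ : ℝ) (x x' : X) : Prop :=
  ∀ z, 2 * τ * F x' + dist x x' ^ 2 + (1 - Λ * τ) * dist x' z ^ 2 ≤ 2 * τ * F z + dist x z ^ 2

theorem LambdaConvex.mono {F : X → ℝ} {a b : ℝ} (h : LambdaConvex b F) (hab : a ≤ b) :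
    LambdaConvex a F := by
  intro γ hγ t ht
  refine (h γ hγ t ht).trans ?_
  have : 0 ≤ t * (1 - t) * dist (γ 0) (γ 1) ^ 2 :=
    mul_nonneg (mul_nonneg ht.1 (by linarith [ht.2])) (sq_nonneg _)
  nlinarith

/-- A locally Lipschitz `-Λ`-convex function is bounded below by a quadratic function. -/
theorem LambdaConvex.exists_quadratic_lower_bound (hX : GeodesicMetricSpace X) {F : X → ℝ} {Λ : ℝ}
    (hF : LambdaConvex (-Λ) F) (hlip : LocallyLipschitz F) (x : X) :
    ∃ L : ℝ, 0 ≤ L ∧ ∀ z, F x - L * dist x z - Λ / 2 * dist x z ^ 2 ≤ F z := by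
  obtain ⟨K, s, hs, hK⟩ := hlip x
  obtain ⟨r, hr, hrs⟩ := Metric.mem_nhds_iff.1 hs
  refine ⟨K, K.2, fun z => ?_⟩
  obtain ⟨γ, hγ, rfl, rfl⟩ := hX x z
  set d := dist (γ 0) (γ 1) with hd
  have hd0 : 0 ≤ d := dist_nonneg
  have key : ∀ᶠ t in nhdsWithin (0:ℝ) (Set.Ioi 0),
      F (γ 0) - K * d - (1 - t) * (Λ / 2) * d ^ 2 ≤ F (γ 1) := by
    have h1 : ∀ᶠ t in nhdsWithin (0:ℝ) (Set.Ioi 0), t * d < r := by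
      have : Tendsto (fun t : ℝ => t * d) (nhdsWithin 0 (Set.Ioi 0)) (nhds (0 * d)) :=
        (continuous_id.mul continuous_const).continuousAt.mono_left nhdsWithin_le_nhds
      exact this.eventually_lt_const (by simpa using hr)
    have h2 : ∀ᶠ t in nhdsWithin (0:ℝ) (Set.Ioi 0), t < 1 :=
      nhdsWithin_le_nhds (Iio_mem_nhds one_pos)
    filter_upwards [h1, h2, self_mem_nhdsWithin] with t h1 h2 h0
    have h0 : 0 < t := h0
    have hdist : dist (γ 0) (γ t) = t * d := by
      rw [hγ 0 ⟨le_rfl, zero_le_one⟩ t ⟨h0.le, h2.le⟩]; simp [abs_of_pos h0, hd]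
    have hl := hK.dist_le_mul (γ 0) (hrs (mem_ball_self hr)) (γ t)
      (hrs (by rw [mem_ball, dist_comm, hdist]; exact h1))
    rw [hdist, Real.dist_eq] at hl
    have hl' := (le_abs_self _).trans hl
    have hc := hF γ hγ t ⟨h0.le, h2.le⟩
    rw [← hd] at hc
    have : t * (F (γ 0) - K * d - (1 - t) * (Λ / 2) * d ^ 2) ≤ t * F (γ 1) := by nlinarith
    exact le_of_mul_le_mul_left this h0
  have lim : Tendsto (fun t : ℝ => F (γ 0) - K * d - (1 - t) * (Λ / 2) * d ^ 2)
      (nhdsWithin 0 (Set.Ioi 0)) (nhds (F (γ 0) - K * d - (1 - 0) * (Λ / 2) * d ^ 2)) :=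
    (by fun_prop : Continuous fun t : ℝ => F (γ 0) - K * d - (1 - t) * (Λ / 2) * d ^ 2
      ).continuousAt.mono_left nhdsWithin_le_nhds
  simpa using le_of_tendsto lim key

theorem exists_isProx [CompleteSpace X] (hX : Cat0 X) {F : X → ℝ} {Λ τ : ℝ}
    (hF : LambdaConvex (-Λ) F) (hlip : LocallyLipschitz F) (hτ : 0 < τ)
    (hΛτ : Λ * τ < 1) (x : X) : ∃ x', IsProx F Λ τ x x' := by
  set Φ : X → ℝ := fun z => 2 * τ * F z + dist x z ^ 2 with hΦ
  have hΦc : Continuous Φ := by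
    have := hlip.continuous
    fun_prop
  have hconv : ∀ γ : ℝ → X, IsGeodesic γ → ∀ t ∈ Set.Icc (0:ℝ) 1,
      Φ (γ t) ≤ (1 - t) * Φ (γ 0) + t * Φ (γ 1)
        - t * (1 - t) * (1 - Λ * τ) * dist (γ 0) (γ 1) ^ 2 := by
    intro γ hγ t ht
    have h1 := hF γ hγ t ht
    have h2 := hX.2 x γ hγ t ht
    simp only [hΦ]
    nlinarith
  obtain ⟨L, -, hL⟩ := hF.exists_quadratic_lower_bound hX.1 hlip x
  have hbdd : BddBelow (Set.range Φ) := by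
    refine ⟨2 * τ * F x - (τ * L) ^ 2 / (1 - Λ * τ), ?_⟩
    rintro _ ⟨z, rfl⟩
    have h := hL z
    have h1 : 0 < 1 - Λ * τ := by linarith
    have : 2 * τ * F x - 2 * τ * L * dist x z + (1 - Λ * τ) * dist x z ^ 2 ≤ Φ z := by
      simp only [hΦ]
      nlinarith
    refine le_trans ?_ this
    have h2 : (τ * L) ^ 2 / (1 - Λ * τ) - 2 * τ * L * dist x z + (1 - Λ * τ) * dist x z ^ 2
        = ((1 - Λ * τ) * dist x z - τ * L) ^ 2 / (1 - Λ * τ) := by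
      generalize 1 - Λ * τ = q at h1
      field_simp
      ring
    have h3 : 0 ≤ ((1 - Λ * τ) * dist x z - τ * L) ^ 2 / (1 - Λ * τ) := by positivity
    linarith
  have : Nonempty X := ⟨x⟩
  set I := ⨅ z, Φ z with hI
  have hIle : ∀ z, I ≤ Φ z := fun z => ciInf_le hbdd z
  have hu : ∀ n : ℕ, ∃ z, Φ z < I + 1 / ((n:ℝ) + 1) := fun n =>
    exists_lt_of_ciInf_lt (lt_add_of_pos_right _ (by positivity))
  choose u hu using hu
  have hdist : ∀ p q : X, (1 - Λ * τ) * dist p q ^ 2 ≤ 2 * (Φ p - I) + 2 * (Φ q - I) := by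
    intro p q
    obtain ⟨γ, hγ, rfl, rfl⟩ := hX.1 p q
    have h := hconv γ hγ (1 / 2) ⟨by norm_num, by norm_num⟩
    have := hIle (γ (1 / 2))
    nlinarith
  have hcau : CauchySeq u := by
    rw [Metric.cauchySeq_iff']
    intro ε hε
    have h1 : 0 < (1 - Λ * τ) * ε ^ 2 := mul_pos (by linarith) (by positivity)
    obtain ⟨N, hN⟩ := exists_nat_one_div_lt (show 0 < (1 - Λ * τ) * ε ^ 2 / 4 by linarith)
    refine ⟨N, fun n hn => ?_⟩
    have h2 := hdist (u n) (u N)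
    have h3 := hu n
    have h4 := hu N
    have h5 : 1 / ((n:ℝ) + 1) ≤ 1 / ((N:ℝ) + 1) := by gcongr
    have h6 : (1 - Λ * τ) * dist (u n) (u N) ^ 2 < (1 - Λ * τ) * ε ^ 2 := by linarith
    exact lt_of_pow_lt_pow_left₀ 2 hε.le (lt_of_mul_lt_mul_left h6 (by linarith))
  obtain ⟨x', hx'⟩ := cauchySeq_tendsto_of_complete hcau
  have hmin : ∀ z, Φ x' ≤ Φ z := by
    intro z
    refine le_trans ?_ (hIle z)
    have h1 : Tendsto (fun n => Φ (u n)) atTop (nhds (Φ x')) := (hΦc.tendsto x').comp hx'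
    have h2 : Tendsto (fun n : ℕ => I + 1 / ((n:ℝ) + 1)) atTop (nhds (I + 0)) :=
      tendsto_const_nhds.add tendsto_one_div_add_atTop_nhds_zero_nat
    rw [add_zero] at h2
    exact le_of_tendsto_of_tendsto' h1 h2 fun n => (hu n).le
  refine ⟨x', fun z => ?_⟩
  obtain ⟨γ, hγ, rfl, rfl⟩ := hX.1 x' z
  have key : ∀ᶠ t in nhdsWithin (0:ℝ) (Set.Ioi 0),
      Φ (γ 0) + (1 - t) * (1 - Λ * τ) * dist (γ 0) (γ 1) ^ 2 ≤ Φ (γ 1) := by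
    have h2 : ∀ᶠ t in nhdsWithin (0:ℝ) (Set.Ioi 0), t < 1 :=
      nhdsWithin_le_nhds (Iio_mem_nhds one_pos)
    filter_upwards [h2, self_mem_nhdsWithin] with t h2 h0
    have h0 : 0 < t := h0
    have h3 := hconv γ hγ t ⟨h0.le, h2.le⟩
    have h4 := hmin (γ t)
    refine le_of_mul_le_mul_left ?_ h0
    nlinarith
  have lim : Tendsto (fun t : ℝ => Φ (γ 0) + (1 - t) * (1 - Λ * τ) * dist (γ 0) (γ 1) ^ 2)
      (nhdsWithin 0 (Set.Ioi 0))
      (nhds (Φ (γ 0) + (1 - 0) * (1 - Λ * τ) * dist (γ 0) (γ 1) ^ 2)) :=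
    (by fun_prop : Continuous fun t : ℝ => Φ (γ 0) + (1 - t) * (1 - Λ * τ) * dist (γ 0) (γ 1) ^ 2
      ).continuousAt.mono_left nhdsWithin_le_nhds
  have := le_of_tendsto lim key
  simp only [hΦ] at this
  linarith

end Prox

section Discrete

variable {X : Type*} [MetricSpace X] {F : X → ℝ} {Λ τ : ℝ} {x : ℕ → X}

theorem IsProx.sq_dist_le {p q : X} (h : IsProx F Λ τ p q) :
    (2 - Λ * τ) * dist p q ^ 2 ≤ 2 * τ * (F p - F q) := by
  have := h p
  rw [dist_self, dist_comm q p] at this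
  nlinarith

theorem IsProx.map_le {p q : X} (hτ : 0 < τ) (hΛτ : Λ * τ ≤ 1) (h : IsProx F Λ τ p q) :
    F q ≤ F p := by
  have h1 := h.sq_dist_le
  have h2 : 0 ≤ (2 - Λ * τ) * dist p q ^ 2 := mul_nonneg (by linarith) (sq_nonneg _)
  have h3 : 0 ≤ 2 * τ * (F p - F q) := h2.trans h1
  have h4 := nonneg_of_mul_nonneg_right h3 (by linarith)
  linarith

theorem antitone_of_isProx (hτ : 0 < τ) (hΛτ : Λ * τ ≤ 1)
    (hx : ∀ n, IsProx F Λ τ (x n) (x (n + 1))) : Antitone (fun n => F (x n)) :=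
  antitone_nat_of_succ_le fun n => (hx n).map_le hτ hΛτ

theorem IsProx.dist_le_of_isProx {p q r : X} (h₁ : IsProx F Λ τ p q) (h₂ : IsProx F Λ τ q r) :
    (1 - Λ * τ) * dist q r ≤ dist p q := by
  have h1 := h₁ r
  have h2 := h₂ q
  rw [dist_self, dist_comm r q] at h2
  have h3 := dist_triangle p q r
  have h4 : dist p r ^ 2 ≤ (dist p q + dist q r) ^ 2 :=
    pow_le_pow_left₀ dist_nonneg h3 2
  rcases (dist_nonneg (x := q) (y := r)).eq_or_lt with h0 | h0
  · rw [← h0, mul_zero]; exact dist_nonneg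
  · refine le_of_mul_le_mul_right ?_ h0
    nlinarith

theorem one_le_one_sub_mul_exp {u : ℝ} (h0 : 0 ≤ u) (h1 : u ≤ 1 / 2) :
    1 ≤ (1 - u) * Real.exp (2 * u) := by
  have := Real.add_one_le_exp (2 * u)
  nlinarith

theorem le_exp_mul_of_pow_mul_le {u a b : ℝ} (h0 : 0 ≤ u) (h1 : u ≤ 1 / 2) (ha : 0 ≤ a) (n : ℕ)
    (h : (1 - u) ^ n * a ≤ b) : a ≤ Real.exp (2 * u * n) * b := by
  have h2 : 1 ≤ ((1 - u) * Real.exp (2 * u)) ^ n :=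
    one_le_pow₀ (one_le_one_sub_mul_exp h0 h1)
  rw [mul_pow, ← Real.exp_nat_mul, mul_comm (n : ℝ)] at h2
  have h3 := Real.exp_pos (2 * u * n)
  calc a = 1 * a := by ring
    _ ≤ ((1 - u) ^ n * Real.exp (2 * u * n)) * a := by gcongr
    _ = Real.exp (2 * u * n) * ((1 - u) ^ n * a) := by ring
    _ ≤ _ := by gcongr

theorem dist_succ_le_of_isProx (hΛ : 0 ≤ Λ) (hτ : 0 < τ) (hΛτ : Λ * τ ≤ 1 / 2) {L : ℝ}
    (hL0 : 0 ≤ L) (hL : ∀ z, F (x 0) - L * dist (x 0) z - Λ / 2 * dist (x 0) z ^ 2 ≤ F z)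
    (hx : ∀ n, IsProx F Λ τ (x n) (x (n + 1))) {T : ℝ} (n : ℕ) (hn : (n + 1) * τ ≤ T) :
    dist (x n) (x (n + 1)) ≤ L * Real.exp (2 * Λ * T) * τ := by
  have key : ∀ n, (1 - Λ * τ) ^ (n + 1) * dist (x n) (x (n + 1)) ≤ τ * L := by
    intro n
    induction n with
    | zero =>
      have h1 := (hx 0).sq_dist_le
      have h2 := hL (x 1)
      simp only [zero_add, pow_one] at h1 ⊢
      rcases (dist_nonneg (x := x 0) (y := x 1)).eq_or_lt with h0 | h0
      · rw [← h0, mul_zero]; positivity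
      · refine le_of_mul_le_mul_right ?_ h0
        nlinarith
    | succ n ih =>
      refine le_trans ?_ ih
      rw [pow_succ _ (n + 1), mul_assoc]
      have h1 : (0:ℝ) ≤ (1 - Λ * τ) ^ (n + 1) := pow_nonneg (by linarith) _
      exact mul_le_mul_of_nonneg_left ((hx n).dist_le_of_isProx (hx (n + 1))) h1
  have h1 := le_exp_mul_of_pow_mul_le (mul_nonneg hΛ hτ.le) hΛτ dist_nonneg (n + 1) (key n)
  refine h1.trans ?_
  have : Real.exp (2 * (Λ * τ) * ((n + 1 : ℕ) : ℝ)) ≤ Real.exp (2 * Λ * T) := by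
    refine Real.exp_le_exp.2 ?_
    push_cast
    nlinarith [mul_le_mul_of_nonneg_left hn hΛ]
  calc _ ≤ Real.exp (2 * Λ * T) * (τ * L) := by gcongr
    _ = _ := by ring

theorem dist_le_of_dist_succ_le {K T : ℝ} (hτ : 0 < τ)
    (hK : ∀ n : ℕ, (n + 1) * τ ≤ T → dist (x n) (x (n + 1)) ≤ K * τ) {i j : ℕ} (hij : i ≤ j)
    (hj : j * τ ≤ T) : dist (x i) (x j) ≤ K * ((j - i) * τ) := by
  induction j, hij using Nat.le_induction with
  | base => simp
  | succ j hij ih =>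
    push_cast at hj ⊢
    have h1 := ih (by nlinarith)
    have h2 := hK j hj
    have h3 := dist_triangle (x i) (x j) (x (j + 1))
    nlinarith

theorem sq_dist_le_of_isProx (hΛτ : Λ * τ ≤ 1)
    (hx : ∀ n, IsProx F Λ τ (x n) (x (n + 1))) {i j : ℕ} (hij : i ≤ j) :
    (1 - Λ * τ / 2) * dist (x i) (x j) ^ 2 ≤ (j - i) * τ * (F (x i) - F (x j)) := by
  have h0 : 0 ≤ 1 - Λ * τ / 2 := by linarith
  have h1 : dist (x i) (x j) ^ 2 ≤
      (j - i) * ∑ n ∈ Finset.Ico i j, dist (x n) (x (n + 1)) ^ 2 := by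
    have h2 := pow_le_pow_left₀ dist_nonneg (dist_le_Ico_sum_dist x hij) 2
    have h3 := sq_sum_le_card_mul_sum_sq (s := Finset.Ico i j)
      (f := fun n => dist (x n) (x (n + 1)))
    rw [Nat.card_Ico, Nat.cast_sub hij] at h3
    exact h2.trans h3
  have h2 : (1 - Λ * τ / 2) * ∑ n ∈ Finset.Ico i j, dist (x n) (x (n + 1)) ^ 2
      ≤ τ * (F (x i) - F (x j)) := by
    rw [← neg_sub (F (x j)), ← Finset.sum_Ico_sub (fun n => F (x n)) hij, ← Finset.sum_neg_distrib,
      Finset.mul_sum, Finset.mul_sum]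
    refine Finset.sum_le_sum fun n _ => ?_
    have := (hx n).sq_dist_le
    linarith
  have h3 : (0:ℝ) ≤ j - i := sub_nonneg.2 (Nat.cast_le.2 hij)
  calc (1 - Λ * τ / 2) * dist (x i) (x j) ^ 2
      ≤ (1 - Λ * τ / 2) * ((j - i) * ∑ n ∈ Finset.Ico i j, dist (x n) (x (n + 1)) ^ 2) := by gcongr
    _ = (j - i) * ((1 - Λ * τ / 2) * ∑ n ∈ Finset.Ico i j, dist (x n) (x (n + 1)) ^ 2) := by ring
    _ ≤ (j - i) * (τ * (F (x i) - F (x j))) := by gcongr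
    _ = _ := by ring

theorem sq_dist_sub_le_of_isProx (hΛ : 0 ≤ Λ) (hτ : 0 < τ) (hΛτ : Λ * τ ≤ 1)
    (hx : ∀ n, IsProx F Λ τ (x n) (x (n + 1))) {K T : ℝ} (hK0 : 0 ≤ K)
    (hK : ∀ n : ℕ, (n + 1) * τ ≤ T → dist (x n) (x (n + 1)) ≤ K * τ) {i j : ℕ} (hij : i ≤ j)
    (hj : j * τ ≤ T) (z : X) :
    dist (x j) z ^ 2 - dist (x i) z ^ 2 ≤ (j - i) * τ *
      (2 * (F z - F (x j)) + Λ * (dist (x i) z + K * ((j - i) * τ)) ^ 2) := by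
  set c := 2 * (F z - F (x j)) + Λ * (dist (x i) z + K * ((j - i) * τ)) ^ 2 with hc
  have step : ∀ n, i ≤ n → n < j → dist (x (n + 1)) z ^ 2 - dist (x n) z ^ 2 ≤ τ * c := by
    intro n hin hnj
    have h1 := hx n z
    have h2 : F (x j) ≤ F (x (n + 1)) := antitone_of_isProx hτ hΛτ hx hnj
    have hnj' : ((n + 1 : ℕ) : ℝ) ≤ j := Nat.cast_le.2 hnj
    have h3 := dist_le_of_dist_succ_le hτ hK (hin.trans n.le_succ)
      ((mul_le_mul_of_nonneg_right hnj' hτ.le).trans hj)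
    have h4 : dist (x (n + 1)) z ≤ dist (x i) z + K * ((j - i) * τ) := by
      have h5 := dist_triangle_left (x (n + 1)) z (x i)
      have h6 : K * ((((n + 1 : ℕ) : ℝ) - i) * τ) ≤ K * ((j - i) * τ) := by gcongr
      linarith
    have h7 : dist (x (n + 1)) z ^ 2 ≤ (dist (x i) z + K * ((j - i) * τ)) ^ 2 :=
      pow_le_pow_left₀ dist_nonneg h4 2
    have h8 : Λ * τ * dist (x (n + 1)) z ^ 2 ≤
        Λ * τ * (dist (x i) z + K * ((j - i) * τ)) ^ 2 := by gcongr
    have h9 := sq_nonneg (dist (x n) (x (n + 1)))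
    have h10 : τ * F (x j) ≤ τ * F (x (n + 1)) := by gcongr
    rw [hc]
    nlinarith
  have hsum : ∑ n ∈ Finset.Ico i j, (dist (x (n + 1)) z ^ 2 - dist (x n) z ^ 2)
      ≤ ∑ n ∈ Finset.Ico i j, τ * c :=
    Finset.sum_le_sum fun n hn => step n (Finset.mem_Ico.1 hn).1 (Finset.mem_Ico.1 hn).2
  rw [Finset.sum_Ico_sub (fun n => dist (x n) z ^ 2) hij, Finset.sum_const, Nat.card_Ico,
    nsmul_eq_mul, Nat.cast_sub hij] at hsum
  linarith

/-- One step of size `τ` compared with two steps of size `τ / 2`. -/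
theorem IsProx.sq_dist_halving_le {p p' q q' q'' : X} (hΛ : 0 ≤ Λ) (hτ : 0 < τ)
    (hΛτ : 8 * (Λ * τ) ≤ 1) (hp : IsProx F Λ τ p p') (hq : IsProx F Λ (τ / 2) q q')
    (hq' : IsProx F Λ (τ / 2) q' q'') :
    (1 - 4 * (Λ * τ)) * dist p' q'' ^ 2 ≤
      dist p q ^ 2 + 4 * τ * ((F p - F p') + (F q - F q'')) := by
  have hu : 0 ≤ Λ * τ := mul_nonneg hΛ hτ.le
  have h1 := hp q''
  have h2 := hq p
  have h3 := hq' p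
  have h4 := hp.sq_dist_le
  have h5 := hq.sq_dist_le
  have h6 := hq'.sq_dist_le
  have m1 : F p' ≤ F p := hp.map_le hτ (by linarith)
  have m2 : F q' ≤ F q := hq.map_le (by linarith) (by linarith)
  have m3 : F q'' ≤ F q' := hq'.map_le (by linarith) (by linarith)
  rw [dist_comm q' p, dist_comm q p] at h2
  rw [dist_comm q'' p, dist_comm q' p] at h3
  have t1 : dist p q'' ^ 2 ≤ (dist p p' + dist p' q'') ^ 2 :=
    pow_le_pow_left₀ dist_nonneg (dist_triangle _ _ _) 2
  have t2 : dist p q' ^ 2 ≤ (dist p p' + dist p' q'' + dist q' q'') ^ 2 :=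
    pow_le_pow_left₀ dist_nonneg
      ((dist_triangle _ q'' _).trans (by
        rw [dist_comm q'' q']; gcongr; exact dist_triangle _ _ _)) 2
  set a := dist p p'
  set b := dist q' q''
  set d := dist p' q''
  have t3 : dist p q'' ^ 2 ≤ 3 * (a ^ 2 + b ^ 2) + 3 * d ^ 2 := by
    nlinarith [sq_nonneg (a - d), sq_nonneg (a + d), sq_nonneg b]
  have t4 : dist p q' ^ 2 ≤ 3 * (a ^ 2 + b ^ 2) + 3 * d ^ 2 := by
    nlinarith [sq_nonneg (a - d), sq_nonneg (a - b), sq_nonneg (b - d)]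
  have a1 : a ^ 2 ≤ 2 * τ * (F p - F p') := by nlinarith [sq_nonneg a]
  have b1 : b ^ 2 ≤ τ * (F q' - F q'') := by nlinarith [sq_nonneg b]
  have s3 := mul_le_mul_of_nonneg_left t3 hu
  have s4 := mul_le_mul_of_nonneg_left t4 hu
  have s5 : Λ * τ * (a ^ 2 + b ^ 2) ≤ 1 / 8 * (a ^ 2 + b ^ 2) :=
    mul_le_mul_of_nonneg_right (by linarith) (by positivity)
  have m4 : τ * F q' ≤ τ * F q := by gcongr
  have m5 : τ * F q'' ≤ τ * F q' := by gcongr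
  have m6 : τ * F p' ≤ τ * F p := by gcongr
  have n1 := sq_nonneg (dist q q')
  have n2 := sq_nonneg a
  have n3 := sq_nonneg b
  nlinarith

theorem sq_dist_halving_le {y : ℕ → X} (hΛ : 0 ≤ Λ) (hτ : 0 < τ)
    (hΛτ : 8 * (Λ * τ) ≤ 1) (hx : ∀ n, IsProx F Λ τ (x n) (x (n + 1)))
    (hy : ∀ n, IsProx F Λ (τ / 2) (y n) (y (n + 1))) (h0 : x 0 = y 0) (n : ℕ) :
    dist (x n) (y (2 * n)) ^ 2 ≤ Real.exp (8 * Λ * (n * τ)) *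
      (4 * τ * ((F (x 0) - F (x n)) + (F (y 0) - F (y (2 * n))))) := by
  have hu : 0 ≤ Λ * τ := mul_nonneg hΛ hτ.le
  have key : ∀ n : ℕ, (1 - 4 * (Λ * τ)) ^ n * dist (x n) (y (2 * n)) ^ 2 ≤
      4 * τ * ((F (x 0) - F (x n)) + (F (y 0) - F (y (2 * n)))) := by
    intro n
    induction n with
    | zero => simp [h0]
    | succ n ih =>
      have h1 := (hx n).sq_dist_halving_le hΛ hτ hΛτ (hy (2 * n)) (hy (2 * n + 1))
      have m1 : F (x (n + 1)) ≤ F (x n) := antitone_of_isProx hτ (by linarith) hx n.le_succ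
      have m2 : F (y (2 * n + 1 + 1)) ≤ F (y (2 * n)) :=
        antitone_of_isProx (half_pos hτ) (by linarith) hy (by omega)
      have hq0 : 0 ≤ (1 - 4 * (Λ * τ)) ^ n := pow_nonneg (by linarith) _
      have hq1 : (1 - 4 * (Λ * τ)) ^ n ≤ 1 := pow_le_one₀ (by linarith) (by linarith)
      have h2 := mul_le_mul_of_nonneg_left h1 hq0
      have h3 : 0 ≤ 4 * τ * ((F (x n) - F (x (n + 1))) + (F (y (2 * n)) - F (y (2 * n + 1 + 1)))) :=
        mul_nonneg (by linarith) (by linarith)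
      have h4 := mul_le_mul_of_nonneg_right hq1 h3
      rw [pow_succ, show 2 * (n + 1) = 2 * n + 1 + 1 by ring]
      nlinarith
  have h1 := le_exp_mul_of_pow_mul_le (u := 4 * (Λ * τ)) (by linarith) (by linarith)
    (sq_nonneg _) n (key n)
  rwa [show 2 * (4 * (Λ * τ)) * (n : ℝ) = 8 * Λ * (n * τ) by ring] at h1

end Discrete

section Flow

variable {X : Type*} [MetricSpace X] [CompleteSpace X]

theorem tendsto_floor_mul_of_tendsto_zero {τ : ℕ → ℝ} (hpos : ∀ k, 0 < τ k)
    (h : Tendsto τ atTop (nhds 0)) {t : ℝ} (ht : 0 ≤ t) :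
    Tendsto (fun k => (⌊t / τ k⌋₊ : ℝ) * τ k) atTop (nhds t) := by
  have hlow : Tendsto (fun k => t - τ k) atTop (nhds t) := by
    simpa using tendsto_const_nhds.sub h
  refine tendsto_of_tendsto_of_tendsto_of_le_of_le hlow tendsto_const_nhds (fun k => ?_)
    fun k => ?_
  · have h1 := Nat.lt_floor_add_one (t / τ k)
    rw [div_lt_iff₀ (hpos k)] at h1
    show t - τ k ≤ _
    linarith
  · have h1 := Nat.floor_le (div_nonneg ht (hpos k).le)
    rwa [le_div_iff₀ (hpos k)] at h1

theorem exists_flow (hX : Cat0 X) {F : X → ℝ} {Λ : ℝ} (hΛ : 0 ≤ Λ)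
    (hF : LambdaConvex (-Λ) F) (hlip : LocallyLipschitz F) (x₀ : X) :
    ∃ m : ℝ → X, m 0 = x₀ ∧
      (∀ s t, 0 ≤ s → s ≤ t → dist (m s) (m t) ^ 2 ≤ (t - s) * (F (m s) - F (m t))) ∧
      ∀ T, ∃ K, 0 ≤ K ∧ ∀ s t, 0 ≤ s → s ≤ t → t ≤ T →
        dist (m s) (m t) ≤ K * (t - s) ∧
        ∀ z, dist (m t) z ^ 2 - dist (m s) z ^ 2 ≤ (t - s) *
          (2 * (F z - F (m t)) + Λ * (dist (m s) z + K * (t - s)) ^ 2) := by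
  set h : ℝ := 1 / (8 * Λ + 1) with hh
  have hh0 : 0 < h := by positivity
  have hhΛ : 8 * (Λ * h) ≤ 1 := by
    rw [hh, mul_one_div, mul_div_assoc', div_le_one (by positivity)]; linarith
  set τ : ℕ → ℝ := fun k => h * (1 / 2) ^ k with hτdef
  have hτ : ∀ k, 0 < τ k := fun k => by positivity
  have hτh : ∀ k, τ k ≤ h := fun k =>
    mul_le_of_le_one_right hh0.le (pow_le_one₀ (by norm_num) (by norm_num))
  have hτsucc : ∀ k, τ (k + 1) = τ k / 2 := fun k => by simp only [hτdef, pow_succ]; ring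
  have hΛτ : ∀ k, 8 * (Λ * τ k) ≤ 1 := fun k =>
    le_trans (by have := mul_le_mul_of_nonneg_left (hτh k) hΛ; linarith) hhΛ
  have hτ0 : Tendsto τ atTop (nhds 0) := by
    rw [← mul_zero h]
    exact (tendsto_pow_atTop_nhds_zero_of_lt_one (by norm_num) (by norm_num)).const_mul h
  choose J hJ using fun k x => exists_isProx hX hF hlip (hτ k)
    (by linarith [hΛτ k, mul_nonneg hΛ (hτ k).le] : Λ * τ k < 1) x
  set x : ℕ → ℕ → X := fun k n => (J k)^[n] x₀ with hxdef
  have hx : ∀ k n, IsProx F Λ (τ k) (x k n) (x k (n + 1)) := fun k n => by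
    simp only [hxdef, Function.iterate_succ_apply']
    exact hJ k _
  have hx0 : ∀ k, x k 0 = x₀ := fun k => rfl
  obtain ⟨L, hL0, hL⟩ := hF.exists_quadratic_lower_bound hX.1 hlip x₀
  set C : ℝ → ℝ := fun T => L * Real.exp (2 * Λ * T) with hC
  have hC0 : ∀ T, 0 ≤ C T := fun T => by positivity
  have hstep : ∀ T k (n : ℕ), (n + 1) * τ k ≤ T → dist (x k n) (x k (n + 1)) ≤ C T * τ k :=
    fun T k n hn => dist_succ_le_of_isProx hΛ (hτ k) (by linarith [hΛτ k]) hL0 hL (hx k) n hn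
  clear_value C
  have hanti : ∀ k, Antitone fun n => F (x k n) := fun k =>
    antitone_of_isProx (hτ k) (by linarith [hΛτ k, mul_nonneg hΛ (hτ k).le]) (hx k)
  have henergy : ∀ T k (n : ℕ), n * τ k ≤ T →
      F x₀ - F (x k n) ≤ L * (C T * T) + Λ / 2 * (C T * T) ^ 2 := by
    intro T k n hn
    have h1 := dist_le_of_dist_succ_le (hτ k) (hstep T k) n.zero_le hn
    have h2 : dist x₀ (x k n) ≤ C T * T := by
      refine h1.trans (mul_le_mul_of_nonneg_left ?_ (hC0 T))
      simpa using hn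
    have h3 := hL (x k n)
    have h4 : dist x₀ (x k n) ^ 2 ≤ (C T * T) ^ 2 := pow_le_pow_left₀ dist_nonneg h2 2
    have h5 := mul_le_mul_of_nonneg_left h2 hL0
    have h6 := mul_le_mul_of_nonneg_left h4 (by positivity : 0 ≤ Λ / 2)
    linarith
  set N : ℝ → ℕ → ℕ := fun t k => ⌊t / τ k⌋₊ with hN
  have hNτ : ∀ t, 0 ≤ t → ∀ k, (N t k : ℝ) * τ k ≤ t := fun t ht k => by
    have h1 := Nat.floor_le (div_nonneg ht (hτ k).le)
    rwa [le_div_iff₀ (hτ k)] at h1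
  have hNsucc : ∀ t, 0 ≤ t → ∀ k, 2 * N t k ≤ N t (k + 1) ∧ N t (k + 1) ≤ 2 * N t k + 1 := by
    intro t ht k
    have e : t / τ (k + 1) = 2 * (t / τ k) := by rw [hτsucc]; field_simp
    have h0 : 0 ≤ t / τ k := div_nonneg ht (hτ k).le
    constructor
    · refine Nat.le_floor ?_
      rw [e]; push_cast
      linarith [Nat.floor_le h0]
    · refine Nat.lt_succ_iff.1 ((Nat.floor_lt (by rw [e]; positivity)).2 ?_)
      rw [e]; push_cast
      linarith [Nat.lt_floor_add_one (t / τ k)]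
  have hNlim : ∀ t, 0 ≤ t → Tendsto (fun k => (N t k : ℝ) * τ k) atTop (nhds t) :=
    fun t ht => tendsto_floor_mul_of_tendsto_zero hτ hτ0 ht
  have hcauchy : ∀ t, 0 ≤ t → CauchySeq fun k => x k (N t k) := by
    intro t ht
    set M := L * (C t * t) + Λ / 2 * (C t * t) ^ 2
    have hM : 0 ≤ M := add_nonneg (mul_nonneg hL0 (mul_nonneg (hC0 t) ht)) (by positivity)
    set B := Real.exp (8 * Λ * t) * (4 * (M + M))
    have hB : 0 ≤ B := by positivity
    set r : ℝ := Real.sqrt (1 / 2)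
    have hr0 : 0 ≤ r := Real.sqrt_nonneg _
    have hr2 : r ^ 2 = 1 / 2 := Real.sq_sqrt (by norm_num)
    have hr1 : r < 1 := by nlinarith
    refine cauchySeq_of_le_geometric r (Real.sqrt (B * h) + C t * h) hr1 fun k => ?_
    set n := N t k
    obtain ⟨l1, l2⟩ := hNsucc t ht k
    have hn : (n : ℝ) * τ k ≤ t := hNτ t ht k
    have hn' : ((2 * n : ℕ) : ℝ) * τ (k + 1) ≤ t := by
      rw [hτsucc]; push_cast; linarith
    have d1 : dist (x k n) (x (k + 1) (2 * n)) ≤ Real.sqrt (B * h) * r ^ k := by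
      refine abs_le_of_sq_le_sq' ?_ (by positivity) |>.2
      have h1 := sq_dist_halving_le (y := x (k + 1)) hΛ (hτ k) (hΛτ k) (hx k)
        (fun n => by rw [← hτsucc]; exact hx (k + 1) n) rfl n
      rw [mul_pow, Real.sq_sqrt (by positivity), ← pow_mul, mul_comm k 2, pow_mul, hr2]
      have e1 := henergy t k n hn
      have e2 := henergy t (k + 1) (2 * n) hn'
      have e0 : 0 ≤ F x₀ - F (x k n) := sub_nonneg.2 (hanti k n.zero_le)
      have e0' : 0 ≤ F x₀ - F (x (k + 1) (2 * n)) := sub_nonneg.2 (hanti (k + 1) (Nat.zero_le _))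
      refine h1.trans ?_
      have : 0 ≤ 4 * τ k := by linarith [hτ k]
      calc Real.exp (8 * Λ * (n * τ k)) * (4 * τ k * ((F x₀ - F (x k n)) +
              (F x₀ - F (x (k + 1) (2 * n)))))
          ≤ Real.exp (8 * Λ * t) * (4 * τ k * (M + M)) := by gcongr
        _ = B * h * (1 / 2) ^ k := by simp only [B, hτdef]; ring
    have d2 : dist (x (k + 1) (2 * n)) (x (k + 1) (N t (k + 1))) ≤ C t * h * r ^ k := by
      refine (dist_le_of_dist_succ_le (hτ (k + 1)) (hstep t (k + 1)) l1
        (hNτ t ht (k + 1))).trans ?_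
      rw [mul_assoc]
      refine mul_le_mul_of_nonneg_left ?_ (hC0 t)
      have l3 : (N t (k + 1) : ℝ) ≤ ((2 * n + 1 : ℕ) : ℝ) := Nat.cast_le.2 l2
      push_cast at l3 ⊢
      have l4 : (1 / 2 : ℝ) ^ k ≤ r ^ k :=
        pow_le_pow_left₀ (by norm_num) (by nlinarith) k
      calc ((N t (k + 1) : ℝ) - 2 * n) * τ (k + 1) ≤ 1 * τ (k + 1) :=
            mul_le_mul_of_nonneg_right (by linarith) (hτ _).le
        _ ≤ τ k := by rw [hτsucc]; linarith [hτ k]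
        _ ≤ h * r ^ k := mul_le_mul_of_nonneg_left l4 hh0.le
    calc _ ≤ _ := dist_triangle _ (x (k + 1) (2 * n)) _
      _ ≤ _ := add_le_add d1 d2
      _ = _ := by ring
  have : Nonempty X := ⟨x₀⟩
  choose! m hm using fun t ht => cauchySeq_tendsto_of_complete (hcauchy t ht)
  have hFm : ∀ t, 0 ≤ t → Tendsto (fun k => F (x k (N t k))) atTop (nhds (F (m t))) :=
    fun t ht => (hlip.continuous.tendsto _).comp (hm t ht)
  have hNmono : ∀ s t, s ≤ t → ∀ k, N s k ≤ N t k := fun s t hst k =>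
    Nat.floor_le_floor (div_le_div_of_nonneg_right hst (hτ k).le)
  have hdiff : ∀ s t, 0 ≤ s → 0 ≤ t →
      Tendsto (fun k => ((N t k : ℝ) - N s k) * τ k) atTop (nhds (t - s)) := fun s t hs ht => by
    simpa only [sub_mul] using (hNlim t ht).sub (hNlim s hs)
  refine ⟨m, ?_, fun s t hs hst => ?_, fun T => ⟨C T, hC0 T, fun s t hs hst hT => ⟨?_, fun z => ?_⟩⟩⟩
  · refine tendsto_nhds_unique (hm 0 le_rfl) ?_
    simp [hN, hx0]
  · have ht := hs.trans hst
    have l1 : Tendsto (fun k => (1 - Λ * τ k / 2) * dist (x k (N s k)) (x k (N t k)) ^ 2) atTop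
        (nhds ((1 - Λ * 0 / 2) * dist (m s) (m t) ^ 2)) :=
      (tendsto_const_nhds.sub ((hτ0.const_mul Λ).div_const 2)).mul
        (((hm s hs).dist (hm t ht)).pow 2)
    have l2 := (hdiff s t hs ht).mul ((hFm s hs).sub (hFm t ht))
    have := le_of_tendsto_of_tendsto' l1 l2 fun k =>
      sq_dist_le_of_isProx (by linarith [hΛτ k, mul_nonneg hΛ (hτ k).le]) (hx k) (hNmono s t hst k)
    simpa using this
  · have ht := hs.trans hst
    exact le_of_tendsto_of_tendsto' ((hm s hs).dist (hm t ht)) ((hdiff s t hs ht).const_mul (C T))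
      fun k => dist_le_of_dist_succ_le (hτ k) (hstep T k) (hNmono s t hst k)
        ((hNτ t ht k).trans hT)
  · have ht := hs.trans hst
    have hds := (hm s hs).dist (tendsto_const_nhds (x := z))
    have hdt := (hm t ht).dist (tendsto_const_nhds (x := z))
    exact le_of_tendsto_of_tendsto' ((hdt.pow 2).sub (hds.pow 2))
      ((hdiff s t hs ht).mul (((tendsto_const_nhds.sub (hFm t ht)).const_mul 2).add
        (((hds.add ((hdiff s t hs ht).const_mul (C T))).pow 2).const_mul Λ)))
      fun k => sq_dist_sub_le_of_isProx hΛ (hτ k)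
        (by linarith [hΛτ k, mul_nonneg hΛ (hτ k).le]) (hx k) (hC0 T) (hstep T k)
        (hNmono s t hst k) ((hNτ t ht k).trans hT) z

end Flow

section Gradient

variable {X : Type*} [MetricSpace X]

theorem absGradient_nonneg (F : X → ℝ) (x : X) : 0 ≤ absGradient F x := le_max_right _ _

theorem LocallyLipschitz.exists_abs_sub_le {F : X → ℝ} (hlip : LocallyLipschitz F) (x : X) :
    ∃ K : ℝ, ∀ᶠ y in nhds x, |F x - F y| ≤ K * dist x y := by
  obtain ⟨K, s, hs, hK⟩ := hlip x
  refine ⟨K, ?_⟩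
  filter_upwards [hs] with y hy
  exact hK.dist_le_mul x (mem_of_mem_nhds hs) y hy

theorem eventually_abs_quotient_le {F : X → ℝ} (hlip : LocallyLipschitz F) (x : X) :
    ∃ K : ℝ, ∀ᶠ y in nhdsWithin x {x}ᶜ, |(F x - F y) / dist x y| ≤ K := by
  obtain ⟨K, hK⟩ := hlip.exists_abs_sub_le x
  refine ⟨K, ?_⟩
  filter_upwards [nhdsWithin_le_nhds hK, self_mem_nhdsWithin] with y hy hne
  have h0 : 0 < dist x y := dist_pos.2 (Ne.symm hne)
  rwa [abs_div, abs_of_pos h0, div_le_iff₀ h0]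

theorem eventually_sub_le_absGradient {F : X → ℝ} (hlip : LocallyLipschitz F) (x : X) {η : ℝ}
    (hη : 0 < η) : ∀ᶠ y in nhds x, F x - F y ≤ (absGradient F x + η) * dist x y := by
  obtain ⟨K, hK⟩ := eventually_abs_quotient_le hlip x
  have h1 : Filter.limsup (fun y => (F x - F y) / dist x y) (nhdsWithin x {x}ᶜ)
      < absGradient F x + η := (le_max_left _ 0).trans_lt (lt_add_of_pos_right _ hη)
  have h2 := eventually_lt_of_limsup_lt h1
    (isBoundedUnder_of_eventually_le (hK.mono fun y hy => (abs_le.1 hy).2))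
  rw [eventually_nhdsWithin_iff] at h2
  filter_upwards [h2] with y hy
  rcases eq_or_ne y x with rfl | hne
  · simp
  · have h0 : 0 < dist x y := dist_pos.2 (Ne.symm hne)
    exact ((div_lt_iff₀ h0).1 (hy hne)).le

theorem frequently_lt_of_lt_absGradient {F : X → ℝ} (hlip : LocallyLipschitz F) (x : X) {b : ℝ}
    (hb0 : 0 ≤ b) (hb : b < absGradient F x) :
    ∃ᶠ y in nhdsWithin x {x}ᶜ, b * dist x y < F x - F y := by
  obtain ⟨K, hK⟩ := eventually_abs_quotient_le hlip x
  have h1 : b < Filter.limsup (fun y => (F x - F y) / dist x y) (nhdsWithin x {x}ᶜ) := by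
    rcases lt_max_iff.1 hb with h | h
    · exact h
    · linarith
  have hne : (nhdsWithin x {x}ᶜ).NeBot := by
    refine ⟨fun h => ?_⟩
    rw [h] at h1
    simp [Filter.limsup, Filter.limsSup] at h1
    linarith
  have h2 := frequently_lt_of_lt_limsup (IsBoundedUnder.isCoboundedUnder_le
    (isBoundedUnder_of_eventually_ge (hK.mono fun y hy => (abs_le.1 hy).1))) h1
  refine (h2.and_eventually self_mem_nhdsWithin).mono fun y hy => ?_
  exact (lt_div_iff₀ (dist_pos.2 (Ne.symm hy.2))).1 hy.1

theorem tendsto_id_nhdsGT :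
    Tendsto (fun ε : ℝ => ε) (nhdsWithin 0 (Set.Ioi 0)) (nhds 0) :=
  tendsto_id.mono_left nhdsWithin_le_nhds

/-- The one-sided energy and variational inequalities at `t` force a curve to be a gradient curve
at `t`. -/
theorem isGradientCurveAt_of_energy_of_evi {F : X → ℝ} (hlip : LocallyLipschitz F) {m : ℝ → X}
    {t Λ K : ℝ}
    (hm : Tendsto (fun ε => m (t + ε)) (nhdsWithin 0 (Set.Ioi 0)) (nhds (m t)))
    (henergy : ∀ᶠ ε in nhdsWithin (0:ℝ) (Set.Ioi 0),
      dist (m t) (m (t + ε)) ^ 2 ≤ ε * (F (m t) - F (m (t + ε))))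
    (hevi : ∀ z, ∀ᶠ ε in nhdsWithin (0:ℝ) (Set.Ioi 0),
      dist (m (t + ε)) z ^ 2 - dist (m t) z ^ 2 ≤
        ε * (2 * (F z - F (m (t + ε))) + Λ * (dist (m t) z + K * ε) ^ 2)) :
    IsGradientCurveAt F m t := by
  set g := absGradient F (m t) with hg
  have hg0 : 0 ≤ g := absGradient_nonneg F _
  set u : ℝ → ℝ := fun ε => dist (m (t + ε)) (m t) / ε with hu
  set v : ℝ → ℝ := fun ε => (F (m (t + ε)) - F (m t)) / ε with hv
  have hueq : ∀ ε > 0, dist (m (t + ε)) (m t) = ε * u ε := fun ε hε => by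
    simp only [hu]; field_simp
  have hveq : ∀ ε > 0, F (m (t + ε)) - F (m t) = ε * v ε := fun ε hε => by
    simp only [hv]; field_simp
  have hu0 : ∀ ε > 0, 0 ≤ u ε := fun ε hε => div_nonneg dist_nonneg hε.le
  have huv : ∀ᶠ ε in nhdsWithin (0:ℝ) (Set.Ioi 0), u ε ^ 2 ≤ -v ε := by
    filter_upwards [henergy, self_mem_nhdsWithin] with ε h hε
    have hε : 0 < ε := hε
    rw [dist_comm, hueq ε hε, ← neg_sub (F (m (t + ε))), hveq ε hε] at h
    refine le_of_mul_le_mul_left ?_ (show 0 < ε ^ 2 by positivity)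
    nlinarith
  have hvu : ∀ η > 0, ∀ᶠ ε in nhdsWithin (0:ℝ) (Set.Ioi 0), -v ε ≤ (g + η) * u ε := by
    intro η hη
    filter_upwards [hm.eventually (eventually_sub_le_absGradient hlip (m t) hη),
      self_mem_nhdsWithin] with ε h hε
    have hε : 0 < ε := hε
    rw [dist_comm, hueq ε hε, ← neg_sub (F (m (t + ε))), hveq ε hε] at h
    refine le_of_mul_le_mul_left ?_ hε
    linarith
  have hupper : ∀ η > 0, ∀ᶠ ε in nhdsWithin (0:ℝ) (Set.Ioi 0), u ε ≤ g + η := by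
    intro η hη
    filter_upwards [huv, hvu η hη, self_mem_nhdsWithin] with ε h1 h2 hε
    by_contra! hcon
    nlinarith
  have hlower : ∀ b < g, ∀ᶠ ε in nhdsWithin (0:ℝ) (Set.Ioi 0), b < u ε := by
    intro b hb
    rcases lt_or_ge b 0 with hb0 | hb0
    · filter_upwards [self_mem_nhdsWithin] with ε hε
      exact hb0.trans_le (hu0 ε hε)
    obtain ⟨c, hbc, hcg⟩ := exists_between hb
    have hclose : ∀ᶠ z in nhdsWithin (m t) {m t}ᶜ, Λ * dist (m t) z < 2 * (c - b) := by
      refine nhdsWithin_le_nhds ?_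
      have : Tendsto (fun z => Λ * dist (m t) z) (nhds (m t)) (nhds (Λ * dist (m t) (m t))) :=
        (by fun_prop : Continuous fun z => Λ * dist (m t) z).tendsto _
      rw [dist_self, mul_zero] at this
      exact this.eventually_lt_const (by linarith)
    obtain ⟨z, hz1, hz2, hz3⟩ := ((frequently_lt_of_lt_absGradient hlip (m t)
      (hb0.trans hbc.le) hcg).and_eventually (hclose.and self_mem_nhdsWithin)).exists
    have hd : 0 < dist (m t) z := dist_pos.2 (Ne.symm hz3)
    set d := dist (m t) z
    have hlim : Tendsto (fun ε => 2 * (F z - F (m (t + ε))) + Λ * (d + K * ε) ^ 2)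
        (nhdsWithin 0 (Set.Ioi 0)) (nhds (2 * (F z - F (m t)) + Λ * (d + K * 0) ^ 2)) :=
      ((tendsto_const_nhds.sub ((hlip.continuous.tendsto _).comp hm)).const_mul 2).add
        (((tendsto_const_nhds.add (tendsto_id_nhdsGT.const_mul K)).pow 2).const_mul Λ)
    have hlt : 2 * (F z - F (m t)) + Λ * (d + K * 0) ^ 2 < -2 * d * b := by nlinarith
    filter_upwards [hevi z, hlim.eventually_lt_const hlt, self_mem_nhdsWithin] with ε h1 h2 hε
    have hε : 0 < ε := hε
    have h3 : d - ε * u ε ≤ dist (m (t + ε)) z := by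
      rw [← hueq ε hε]
      linarith [dist_triangle_left (m t) z (m (t + ε))]
    have h4 : -2 * d * (ε * u ε) ≤ dist (m (t + ε)) z ^ 2 - d ^ 2 := by
      have h5 := dist_triangle_left (m t) z (m (t + ε))
      rw [hueq ε hε] at h5
      have h6 : 0 ≤ ε * u ε := mul_nonneg hε.le (hu0 ε hε)
      have h7 : 0 ≤ dist (m (t + ε)) z := dist_nonneg
      rcases le_total (ε * u ε) d with h8 | h8
      · nlinarith
      · nlinarith
    have h5 : ε * (-2 * d * u ε) < ε * (-2 * d * b) := by
      have := mul_lt_mul_of_pos_left h2 hε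
      linarith
    have h6 := lt_of_mul_lt_mul_left h5 hε.le
    by_contra! hcon
    nlinarith
  have hutend : Tendsto u (nhdsWithin 0 (Set.Ioi 0)) (nhds g) := by
    refine tendsto_order.2 ⟨hlower, fun b hb => ?_⟩
    filter_upwards [hupper ((b - g) / 2) (by linarith)] with ε h
    linarith
  refine ⟨hutend, ?_⟩
  have hvtend : Tendsto (fun ε => -v ε) (nhdsWithin 0 (Set.Ioi 0)) (nhds (g ^ 2)) := by
    refine tendsto_order.2 ⟨fun b hb => ?_, fun b hb => ?_⟩
    · filter_upwards [huv, (hutend.pow 2).eventually_const_lt hb] with ε h1 h2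
      linarith
    · have hlim : Tendsto (fun η : ℝ => (g + η) * g) (nhdsWithin 0 (Set.Ioi 0))
          (nhds ((g + 0) * g)) := (tendsto_const_nhds.add tendsto_id_nhdsGT).mul_const g
      obtain ⟨η, h1, hη⟩ := ((hlim.eventually_lt_const (by linarith [sq g] : (g + 0) * g < b)).and
        self_mem_nhdsWithin).exists
      filter_upwards [hvu η hη, (hutend.const_mul (g + η)).eventually_lt_const h1] with ε h2 h3
      exact h2.trans_lt h3
  simpa using hvtend.neg

/-- Gradient curves satisfy the evolution variational inequality. -/
theorem IsGradientCurveAt.eventually_evi (hX : Cat0 X) {F : X → ℝ} {lam : ℝ}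
    (hF : LambdaConvex lam F) (hlip : LocallyLipschitz F) {m : ℝ → X} {t : ℝ}
    (h : IsGradientCurveAt F m t) (z : X) {r : ℝ}
    (hr : 2 * (F z - F (m t)) - lam * dist (m t) z ^ 2 < r) :
    ∀ᶠ ε in nhdsWithin (0:ℝ) (Set.Ioi 0),
      dist (m (t + ε)) z ^ 2 - dist (m t) z ^ 2 < ε * r := by
  obtain ⟨hut, hvt⟩ := h
  set x := m t
  set g := absGradient F x
  set d := dist x z
  set u : ℝ → ℝ := fun ε => dist (m (t + ε)) x / ε with hu
  set v : ℝ → ℝ := fun ε => (F (m (t + ε)) - F x) / ε with hv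
  have hueq : ∀ ε > 0, dist (m (t + ε)) x = ε * u ε := fun ε hε => by
    simp only [hu]; field_simp
  have hveq : ∀ ε > 0, F (m (t + ε)) = F x + ε * v ε := fun ε hε => by
    simp only [hv]; field_simp; ring
  have hdist0 : Tendsto (fun ε => dist (m (t + ε)) x) (nhdsWithin 0 (Set.Ioi 0)) (nhds 0) := by
    have : Tendsto (fun ε => ε * u ε) (nhdsWithin 0 (Set.Ioi 0)) (nhds (0 * g)) :=
      tendsto_id_nhdsGT.mul hut
    rw [zero_mul] at this
    refine this.congr' ?_
    filter_upwards [self_mem_nhdsWithin] with ε hε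
    exact (hueq ε hε).symm
  have hm : Tendsto (fun ε => m (t + ε)) (nhdsWithin 0 (Set.Ioi 0)) (nhds x) :=
    tendsto_iff_dist_tendsto_zero.2 hdist0
  set D : ℝ → ℝ := fun ε => dist (m (t + ε)) z with hD
  have hDt : Tendsto D (nhdsWithin 0 (Set.Ioi 0)) (nhds d) := hm.dist tendsto_const_nhds
  obtain ⟨c, hc0, hc⟩ : ∃ c > 0, 2 * (F z - F x) - lam * d ^ 2 + c * d ^ 2 < r := by
    have hlim : Tendsto (fun c : ℝ => 2 * (F z - F x) - lam * d ^ 2 + c * d ^ 2)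
        (nhdsWithin 0 (Set.Ioi 0)) (nhds (2 * (F z - F x) - lam * d ^ 2 + 0 * d ^ 2)) :=
      tendsto_const_nhds.add (tendsto_id_nhdsGT.mul_const _)
    obtain ⟨c, h1, h2⟩ := ((hlim.eventually_lt_const (by linarith)).and self_mem_nhdsWithin).exists
    exact ⟨c, h2, h1⟩
  obtain ⟨η, hη0, hη⟩ : ∃ η > 0, (g + η) ^ 2 - g ^ 2 +
      c * (2 * (F z - F x) - lam * d ^ 2 + c * d ^ 2) < c * r := by
    have hlim : Tendsto (fun η : ℝ => (g + η) ^ 2 - g ^ 2 +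
          c * (2 * (F z - F x) - lam * d ^ 2 + c * d ^ 2))
        (nhdsWithin 0 (Set.Ioi 0)) (nhds ((g + 0) ^ 2 - g ^ 2 +
          c * (2 * (F z - F x) - lam * d ^ 2 + c * d ^ 2))) :=
      (((tendsto_const_nhds.add tendsto_id_nhdsGT).pow 2).sub_const _).add_const _
    have hlt := mul_lt_mul_of_pos_left hc hc0
    obtain ⟨η, h1, h2⟩ := ((hlim.eventually_lt_const (u := c * r) (by linarith)).and
      self_mem_nhdsWithin).exists
    exact ⟨η, h2, h1⟩
  choose γ hγ hγ0 hγ1 using fun p : X => hX.1 p z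
  set P : ℝ → X := fun ε => γ (m (t + ε)) (c * ε) with hP
  have hcε : Tendsto (fun ε : ℝ => c * ε) (nhdsWithin 0 (Set.Ioi 0)) (nhds 0) := by
    simpa using tendsto_id_nhdsGT.const_mul c
  have hsmall : ∀ᶠ ε in nhdsWithin (0:ℝ) (Set.Ioi 0), c * ε < 1 :=
    hcε.eventually_lt_const one_pos
  have hPt : Tendsto P (nhdsWithin 0 (Set.Ioi 0)) (nhds x) := by
    rw [tendsto_iff_dist_tendsto_zero]
    have hlim : Tendsto (fun ε => c * ε * D ε + dist (m (t + ε)) x) (nhdsWithin 0 (Set.Ioi 0))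
        (nhds (0 * d + 0)) := (hcε.mul hDt).add hdist0
    rw [zero_mul, add_zero] at hlim
    refine tendsto_of_tendsto_of_tendsto_of_le_of_le' tendsto_const_nhds hlim
      (Eventually.of_forall fun _ => dist_nonneg) ?_
    filter_upwards [hsmall, self_mem_nhdsWithin] with ε h1 hε
    have hε : 0 < ε := hε
    have hcε0 : 0 < c * ε := mul_pos hc0 hε
    refine (dist_triangle (P ε) (m (t + ε)) x).trans (add_le_add_left ?_ _)
    have := hγ (m (t + ε)) (c * ε) ⟨hcε0.le, h1.le⟩ 0 ⟨le_rfl, zero_le_one⟩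
    rw [hγ0, hγ1, sub_zero, abs_of_pos hcε0] at this
    exact this.le
  have hmain : ∀ᶠ ε in nhdsWithin (0:ℝ) (Set.Ioi 0),
      (1 - c * ε) * c * (D ε ^ 2 - d ^ 2) ≤
        ε * ((g + η) ^ 2 + (1 - c * ε) * u ε ^ 2 + c ^ 2 * d ^ 2 + 2 * (1 - c * ε) * v ε
          - 2 * c * (F x - F z) - c * (1 - c * ε) * lam * D ε ^ 2) := by
    filter_upwards [hsmall, hPt.eventually (eventually_sub_le_absGradient hlip x hη0),
      self_mem_nhdsWithin] with ε h1 h2 hε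
    have hε : 0 < ε := hε
    have hs : c * ε ∈ Set.Icc (0:ℝ) 1 := ⟨(mul_pos hc0 hε).le, h1.le⟩
    have h3 := hX.2 x (γ (m (t + ε))) (hγ _) (c * ε) hs
    have h4 := hF (γ (m (t + ε))) (hγ _) (c * ε) hs
    rw [hγ0, hγ1] at h3 h4
    rw [dist_comm x (m (t + ε)), hueq ε hε] at h3
    rw [hveq ε hε] at h4
    change dist x (P ε) ^ 2 ≤ (1 - c * ε) * (ε * u ε) ^ 2 + c * ε * d ^ 2
      - c * ε * (1 - c * ε) * D ε ^ 2 at h3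
    change F (P ε) ≤ (1 - c * ε) * (F x + ε * v ε) + c * ε * F z
      - c * ε * (1 - c * ε) * (lam / 2) * D ε ^ 2 at h4
    have h5 : 2 * ε * (F x - F (P ε)) ≤ (ε * (g + η)) ^ 2 + dist x (P ε) ^ 2 := by
      have h6 := mul_le_mul_of_nonneg_left h2 hε.le
      nlinarith [sq_nonneg (ε * (g + η) - dist x (P ε))]
    have h6 := mul_le_mul_of_nonneg_left h4 hε.le
    refine le_of_mul_le_mul_left ?_ hε
    nlinarith
  have hlim : Tendsto (fun ε => ((g + η) ^ 2 + (1 - c * ε) * u ε ^ 2 + c ^ 2 * d ^ 2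
        + 2 * (1 - c * ε) * v ε - 2 * c * (F x - F z) - c * (1 - c * ε) * lam * D ε ^ 2)
        - (1 - c * ε) * c * r)
      (nhdsWithin 0 (Set.Ioi 0)) (nhds (((g + η) ^ 2 + (1 - 0) * g ^ 2 + c ^ 2 * d ^ 2
        + 2 * (1 - 0) * (-g ^ 2) - 2 * c * (F x - F z) - c * (1 - 0) * lam * d ^ 2)
        - (1 - 0) * c * r)) := by
    have h1 : Tendsto (fun ε : ℝ => 1 - c * ε) (nhdsWithin 0 (Set.Ioi 0)) (nhds (1 - 0)) :=
      tendsto_const_nhds.sub hcε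
    exact (((((tendsto_const_nhds.add (h1.mul (hut.pow 2))).add_const _).add
      ((h1.const_mul 2).mul hvt)).sub_const _).sub
      (((h1.const_mul c).mul_const lam).mul (hDt.pow 2))).sub ((h1.mul_const c).mul_const r)
  filter_upwards [hmain, hlim.eventually_lt_const (by linarith : _ < (0:ℝ)), hsmall,
    self_mem_nhdsWithin] with ε h1 h2 h3 hε
  have hε : 0 < ε := hε
  have h4 : 0 < (1 - c * ε) * c := mul_pos (by linarith) hc0
  refine lt_of_mul_lt_mul_left ?_ h4.le
  have h5 := mul_neg_of_pos_of_neg hε h2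
  linarith

end Gradient

section Uniqueness

variable {X : Type*} [MetricSpace X]

/-- The squared distance between two gradient curves has upper right derivative at most
`-2 * lam` times itself. -/
theorem IsGradientCurveAt.eventually_sq_dist_sub_lt (hX : Cat0 X) {F : X → ℝ} {lam : ℝ}
    (hF : LambdaConvex lam F) (hlip : LocallyLipschitz F) {m₁ m₂ : ℝ → X} {t : ℝ}
    (h₁ : IsGradientCurveAt F m₁ t) (h₂ : IsGradientCurveAt F m₂ t) {r : ℝ}
    (hr : -2 * lam * dist (m₁ t) (m₂ t) ^ 2 < r) :
    ∀ᶠ ε in nhdsWithin (0:ℝ) (Set.Ioi 0),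
      dist (m₁ (t + ε)) (m₂ (t + ε)) ^ 2 - dist (m₁ t) (m₂ t) ^ 2 < ε * r := by
  obtain ⟨γ, hγ, hγ0, hγ1⟩ := hX.1 (m₁ t) (m₂ t)
  have hmid : (1 / 2 : ℝ) ∈ Set.Icc (0:ℝ) 1 := ⟨by norm_num, by norm_num⟩
  have d1 := hγ 0 ⟨le_rfl, zero_le_one⟩ (1 / 2) hmid
  have d2 := hγ 1 ⟨zero_le_one, le_rfl⟩ (1 / 2) hmid
  have hc := hF γ hγ (1 / 2) hmid
  rw [hγ0, hγ1] at hc d1 d2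
  set z := γ (1 / 2)
  set d := dist (m₁ t) (m₂ t)
  have d1' : dist (m₁ t) z = d / 2 := by rw [d1, abs_of_neg (by norm_num)]; ring
  have d2' : dist (m₂ t) z = d / 2 := by rw [d2, abs_of_pos (by norm_num)]; ring
  set δ := (r + 2 * lam * d ^ 2) / 8 with hδ
  have hδ0 : 0 < δ := by rw [hδ]; linarith
  have e1 := h₁.eventually_evi hX hF hlip z (lt_add_of_pos_right _ hδ0)
  have e2 := h₂.eventually_evi hX hF hlip z (lt_add_of_pos_right _ hδ0)
  rw [d1'] at e1
  rw [d2'] at e2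
  filter_upwards [e1, e2, self_mem_nhdsWithin] with ε e1 e2 hε
  have hε : 0 < ε := hε
  have h3 : dist (m₁ (t + ε)) (m₂ (t + ε)) ^ 2 ≤
      (dist (m₁ (t + ε)) z + dist (m₂ (t + ε)) z) ^ 2 :=
    pow_le_pow_left₀ dist_nonneg (dist_triangle_right _ _ _) 2
  have h4 := sq_nonneg (dist (m₁ (t + ε)) z - dist (m₂ (t + ε)) z)
  have h5 : 2 * (2 * (F z - F (m₁ t)) - lam * (d / 2) ^ 2 + δ)
      + 2 * (2 * (F z - F (m₂ t)) - lam * (d / 2) ^ 2 + δ) ≤ r := by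
    rw [hδ]
    linarith
  have h6 := mul_le_mul_of_nonneg_left h5 hε.le
  linarith

theorem LocLipschitzOn.continuousOn {Y Z : Type*} [MetricSpace Y] [MetricSpace Z] {f : Y → Z}
    {D : Set Y} (h : LocLipschitzOn f D) : ContinuousOn f D := by
  intro t ht
  obtain ⟨K, ε, hε, hK⟩ := h t ht
  have := hK.continuousOn t ⟨ht, mem_ball_self hε⟩
  exact (continuousWithinAt_inter (ball_mem_nhds t hε)).1 this

theorem eqOn_Icc_of_isGradientCurveAt (hX : Cat0 X) {F : X → ℝ} {lam : ℝ}
    (hF : LambdaConvex lam F) (hlip : LocallyLipschitz F) {m₁ m₂ : ℝ → X} {a b : ℝ}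
    (hc₁ : ContinuousOn m₁ (Set.Icc a b)) (hc₂ : ContinuousOn m₂ (Set.Icc a b))
    (h₁ : ∀ t ∈ Set.Ico a b, IsGradientCurveAt F m₁ t)
    (h₂ : ∀ t ∈ Set.Ico a b, IsGradientCurveAt F m₂ t) (h0 : m₁ a = m₂ a) :
    Set.EqOn m₁ m₂ (Set.Icc a b) := by
  intro t ht
  have hb := le_gronwallBound_of_liminf_deriv_right_le
    (f := fun t => dist (m₁ t) (m₂ t) ^ 2) (f' := fun t => -2 * lam * dist (m₁ t) (m₂ t) ^ 2)
    (δ := 0) (K := -2 * lam) (ε := 0) ((continuous_dist.comp_continuousOn (hc₁.prodMk hc₂)).pow 2)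
    (fun s hs r hr => ?_)
    (by simp [h0]) (fun s _ => by simp) t ht
  · rw [gronwallBound_ε0_δ0] at hb
    exact dist_eq_zero.1 (pow_eq_zero_iff two_ne_zero |>.1 (le_antisymm hb (sq_nonneg _)))
  · have hev := (h₁ s hs).eventually_sq_dist_sub_lt hX hF hlip (h₂ s hs) hr
    refine Eventually.frequently ?_
    have hsub : Tendsto (fun w : ℝ => w - s) (nhdsWithin s (Set.Ioi s))
        (nhdsWithin 0 (Set.Ioi 0)) := by
      refine tendsto_nhdsWithin_iff.2 ⟨?_, ?_⟩
      · rw [← sub_self s]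
        exact (continuous_sub_right s).continuousAt.mono_left nhdsWithin_le_nhds
      · filter_upwards [self_mem_nhdsWithin] with w hw
        exact sub_pos.2 (Set.mem_Ioi.1 hw)
    filter_upwards [hsub.eventually hev, self_mem_nhdsWithin] with w hw hsw
    rw [add_sub_cancel] at hw
    rw [← div_eq_inv_mul, div_lt_iff₀ (sub_pos.2 hsw), mul_comm r]
    exact hw

end Uniqueness

theorem nonneg_of_mem_gradDomain {A t : ℝ} (ht : t ∈ GradDomain A) : 0 ≤ t := by
  unfold GradDomain at ht
  split_ifs at ht
  · exact ht
  · exact ht.1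

theorem Icc_subset_gradDomain {A t : ℝ} (ht : t ∈ GradDomain A) :
    Set.Icc 0 t ⊆ GradDomain A := by
  intro s hs
  unfold GradDomain at ht ⊢
  split_ifs at ht ⊢
  · exact hs.1
  · exact ⟨hs.1, hs.2.trans ht.2⟩

theorem eq_zero_or_lt_of_mem_gradDomain {A t : ℝ} (ht : t ∈ GradDomain A) {s : ℝ} (hs : s < t) :
    A = 0 ∨ s < 1 / (16 * A) := by
  unfold GradDomain at ht
  split_ifs at ht with hA
  · exact Or.inl hA
  · exact Or.inr (hs.trans_le ht.2)


theorem stmt5 {X : Type*} [MetricSpace X] [CompleteSpace X] (hX : Cat0 X)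
    (lam : ℝ) (F : X → ℝ) (hconv : LambdaConvex lam F) (hlip : LocallyLipschitz F)
    (y : X) (A : ℝ) (hA : 0 ≤ A)
    (hgrowth : ∀ ε > 0, ∃ R > 0, ∀ x : X, R ≤ dist x y →
      -(A + ε) * dist x y ^ 2 ≤ F x)
    (x₀ : X) :
    (∃ m : ℝ → X, IsGradSolution F A x₀ m ∧ ∀ t ∈ GradDomain A, F (m t) ≤ F x₀) ∧
    (∀ m₁ m₂ : ℝ → X, IsGradSolution F A x₀ m₁ → IsGradSolution F A x₀ m₂ →
      ∀ t ∈ GradDomain A, m₁ t = m₂ t) := by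
  refine ⟨?_, fun m₁ m₂ h₁ h₂ t ht => ?_⟩
  · have hF : LambdaConvex (-|lam|) F := hconv.mono (neg_abs_le lam)
    obtain ⟨m, hm0, henergy, hm⟩ := exists_flow hX (abs_nonneg lam) hF hlip x₀
    refine ⟨m, ⟨hm0, fun t ht => ?_, fun t ht _ => ?_⟩, fun t ht => ?_⟩
    · obtain ⟨K, hK0, hK⟩ := hm (t + 1)
      refine ⟨⟨K, hK0⟩, 1, one_pos, LipschitzOnWith.of_dist_le_mul fun a ha b hb => ?_⟩
      have bound : ∀ c ∈ GradDomain A ∩ Metric.ball t 1, 0 ≤ c ∧ c ≤ t + 1 := fun c hc =>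
        ⟨nonneg_of_mem_gradDomain hc.1, by
          have := (abs_lt.1 (mem_ball.1 hc.2 : |c - t| < 1)).2
          linarith⟩
      rw [Real.dist_eq]
      rcases le_total a b with hab | hab
      · rw [abs_sub_comm, abs_of_nonneg (sub_nonneg.2 hab)]
        exact (hK a b (bound a ha).1 hab (bound b hb).2).1
      · rw [dist_comm, abs_of_nonneg (sub_nonneg.2 hab)]
        exact (hK b a (bound b hb).1 hab (bound a ha).2).1
    · have ht0 := nonneg_of_mem_gradDomain ht
      obtain ⟨K, hK0, hK⟩ := hm (t + 1)
      have hsmall : ∀ᶠ ε in nhdsWithin (0:ℝ) (Set.Ioi 0), 0 < ε ∧ ε < 1 :=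
        Filter.Eventually.and self_mem_nhdsWithin
          (nhdsWithin_le_nhds (Iio_mem_nhds one_pos))
      refine isGradientCurveAt_of_energy_of_evi hlip (K := K) (Λ := |lam|) ?_ ?_ fun z => ?_
      · rw [tendsto_iff_dist_tendsto_zero]
        have hlim : Tendsto (fun ε : ℝ => K * ε) (nhdsWithin 0 (Set.Ioi 0)) (nhds 0) := by
          simpa using tendsto_id_nhdsGT.const_mul K
        refine tendsto_of_tendsto_of_tendsto_of_le_of_le' tendsto_const_nhds hlim
          (Eventually.of_forall fun _ => dist_nonneg) ?_
        filter_upwards [hsmall] with ε hε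
        have := (hK t (t + ε) ht0 (by linarith) (by linarith)).1
        rwa [dist_comm, add_sub_cancel_left] at this
      · filter_upwards [hsmall] with ε hε
        have := henergy t (t + ε) ht0 (by linarith)
        rwa [add_sub_cancel_left] at this
      · filter_upwards [hsmall] with ε hε
        have := (hK t (t + ε) ht0 (by linarith) (by linarith)).2 z
        rwa [add_sub_cancel_left] at this
    · have ht0 := nonneg_of_mem_gradDomain ht
      have h := henergy 0 t le_rfl ht0
      rw [hm0, sub_zero] at h
      rcases ht0.eq_or_lt with rfl | hpos
      · rw [hm0]
      · exact sub_nonneg.1 (nonneg_of_mul_nonneg_right ((sq_nonneg _).trans h) hpos)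
  · have hsub := Icc_subset_gradDomain ht
    exact eqOn_Icc_of_isGradientCurveAt hX hconv hlip (h₁.2.1.continuousOn.mono hsub)
      (h₂.2.1.continuousOn.mono hsub)
      (fun s hs => h₁.2.2 s (hsub ⟨hs.1, hs.2.le⟩) (eq_zero_or_lt_of_mem_gradDomain ht hs.2))
      (fun s hs => h₂.2.2 s (hsub ⟨hs.1, hs.2.le⟩) (eq_zero_or_lt_of_mem_gradDomain ht hs.2))
      (h₁.1.trans h₂.1.symm) ⟨nonneg_of_mem_gradDomain ht, le_rfl⟩
end

section
/- Let X be a complete CAT(0) space and let (Y_t)_{t} be a family of nonempty closed convex subsets of X indexed by real numbers t such that for all t, t', every point of Y_t is within distance |t−t'| of Y_{t'} and every point of Y_{t'} is within distance |t−t'| of Y_t (i.e. the Hausdorff distance satisfies d_H(Y_t, Y_{t'}) ≤ |t−t'|). Fix p ∈ X and let q_t denote the footpoint of p in Y_t. Then for all t and t': (i) |d(p,q_t) − d(p,q_{t'})| ≤ |t−t'|, and (ii) d(q_t, q_{t'}) ≤ ( √|t−t'| + 2·√( d(p,q_t) + |t−t'| ) ) · √|t−t'|. -/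
open Metric Filter

/-- In a CAT(0) space, a nearest point `q` to `p` in a convex set `Y` satisfies the obtuse-angle
inequality against every other point of `Y`. -/
theorem Cat0.dist_sq_add_dist_sq_le {X : Type*} [MetricSpace X] (hX : Cat0 X) {Y : Set X}
    (hY : GeoConvex Y) {p q z : X} (hq : q ∈ Y) (hmin : ∀ y ∈ Y, dist p q ≤ dist p y)
    (hz : z ∈ Y) : dist p q ^ 2 + dist q z ^ 2 ≤ dist p z ^ 2 := by
  obtain ⟨γ, hγ, rfl, rfl⟩ := hX.1 q z
  by_contra! hlt
  have hle : dist p (γ 0) ^ 2 ≤ dist p (γ 1) ^ 2 :=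
    pow_le_pow_left₀ dist_nonneg (hmin _ hz) 2
  set A := dist p (γ 0) ^ 2
  set B := dist p (γ 1) ^ 2
  set D := dist (γ 0) (γ 1) ^ 2
  have hD : 0 < D := by linarith
  obtain ⟨t, ht⟩ : ∃ t, t = (A + D - B) / (2 * D) := ⟨_, rfl⟩
  have htD : t * D = (A + D - B) / 2 := by rw [ht]; field_simp
  have ht0 : 0 < t := by rw [ht]; exact div_pos (by linarith) (by linarith)
  have ht1 : t ≤ 1 := by rw [ht, div_le_one (by linarith)]; linarith
  have hconv : dist p (γ t) ^ 2 ≤ (1 - t) * A + t * B - t * (1 - t) * D :=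
    hX.2 p γ hγ t ⟨ht0.le, ht1⟩
  have hfoot : A ≤ dist p (γ t) ^ 2 :=
    pow_le_pow_left₀ dist_nonneg (hmin _ (hY γ hγ hq hz t ⟨ht0.le, ht1⟩)) 2
  have hexp : (1 - t) * A + t * B - t * (1 - t) * D = A - t * (A + D - B - t * D) := by ring
  have hpos : 0 < t * (A + D - B - t * D) := mul_pos ht0 (by linarith)
  linarith

theorem stmt12 {X : Type*} [MetricSpace X] [CompleteSpace X] (hX : Cat0 X)
    (Y : ℝ → Set X) (hne : ∀ t, (Y t).Nonempty) (hcl : ∀ t, IsClosed (Y t))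
    (hconv : ∀ t, GeoConvex (Y t))
    (hH : ∀ t t' : ℝ, ∀ x ∈ Y t, Metric.infDist x (Y t') ≤ |t - t'|)
    (p : X) (q : ℝ → X)
    (hq : ∀ t, q t ∈ Y t ∧ dist p (q t) = Metric.infDist p (Y t)) :
    ∀ t t' : ℝ,
      |dist p (q t) - dist p (q t')| ≤ |t - t'| ∧
      dist (q t) (q t') ≤
        (Real.sqrt |t - t'| + 2 * Real.sqrt (dist p (q t) + |t - t'|)) *
          Real.sqrt |t - t'| := by
  have hlip : ∀ t t', dist p (q t') ≤ dist p (q t) + |t - t'| := fun t t' => by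
    have := Metric.infDist_le_infDist_add_dist (s := Y t') (x := p) (y := q t)
    linarith [(hq t').2, hH t t' _ (hq t).1]
  intro t t'
  have hb := hlip t t'
  refine ⟨abs_sub_le_iff.2 ⟨?_, by linarith⟩, ?_⟩
  · have := hlip t' t
    rw [abs_sub_comm] at this
    linarith
  have hdist : Metric.infDist (q t') (Y t) ≤ |t - t'| := by
    rw [abs_sub_comm]; exact hH t' t _ (hq t').1
  have hδ := abs_nonneg (t - t')
  have ha : 0 ≤ dist p (q t) := dist_nonneg
  generalize |t - t'| = δ at *
  have happrox : ∀ ε > 0, dist (q t) (q t') ≤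
      Real.sqrt ((dist p (q t) + 2 * δ + ε) ^ 2 - dist p (q t) ^ 2) + (δ + ε) := by
    intro ε hε
    obtain ⟨z, hz, hqz⟩ :=
      (Metric.infDist_lt_iff (hne t)).1 (hdist.trans_lt (lt_add_of_pos_right δ hε))
    have hmin : ∀ y ∈ Y t, dist p (q t) ≤ dist p y := fun y hy =>
      (hq t).2.trans_le (Metric.infDist_le_dist_of_mem hy)
    have hobt := hX.dist_sq_add_dist_sq_le (hconv t) (hq t).1 hmin hz
    have hpz : dist p z ≤ dist p (q t) + 2 * δ + ε := by
      linarith [dist_triangle p (q t') z]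
    have hsq := pow_le_pow_left₀ dist_nonneg hpz 2
    have hqtz := Real.le_sqrt_of_sq_le
      (show dist (q t) z ^ 2 ≤ (dist p (q t) + 2 * δ + ε) ^ 2 - dist p (q t) ^ 2 by linarith)
    linarith [dist_triangle_right (q t) (q t') z]
  have hlim : Tendsto
      (fun ε : ℝ => Real.sqrt ((dist p (q t) + 2 * δ + ε) ^ 2 - dist p (q t) ^ 2) + (δ + ε))
      (nhdsWithin 0 (Set.Ioi 0))
      (nhds (Real.sqrt ((dist p (q t) + 2 * δ + 0) ^ 2 - dist p (q t) ^ 2) + (δ + 0))) :=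
    (Continuous.tendsto (by fun_prop) 0).mono_left nhdsWithin_le_nhds
  refine (ge_of_tendsto hlim (eventually_mem_nhdsWithin.mono happrox)).trans_eq ?_
  have hfactor : (dist p (q t) + 2 * δ + 0) ^ 2 - dist p (q t) ^ 2 =
      2 ^ 2 * ((dist p (q t) + δ) * δ) := by ring
  rw [hfactor, Real.sqrt_mul (by norm_num), Real.sqrt_sq (by norm_num),
    Real.sqrt_mul (by linarith), add_mul, Real.mul_self_sqrt hδ]
  ring
end

section
/- Let X be a complete CAT(0) space and let Y and Y' be nonempty closed convex subsets of X such that every point of Y is within distance δ of Y' and every point of Y' is within distance δ of Y, where 0 < δ ≤ R for some R > 0. Fix p ∈ X, let q be the footpoint of p in Y and q' the footpoint of p in Y', and assume d(p,q) ≤ 2R. Then d(q,q') ≤ 5·√R·√δ. -/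
open Metric Filter

/-- Projection inequality: the angle at the footpoint is at least a right angle. -/
theorem Cat0.sq_dist_add_sq_dist_le {X : Type*} [MetricSpace X] (hX : Cat0 X) {Y : Set X}
    (hconv : GeoConvex Y) {p q y : X} (hqY : q ∈ Y) (hq : dist p q = Metric.infDist p Y)
    (hy : y ∈ Y) : dist p q ^ 2 + dist q y ^ 2 ≤ dist p y ^ 2 := by
  obtain ⟨γ, hγ, rfl, rfl⟩ := hX.1 q y
  have key : ∀ t : ℝ, 0 < t → t ≤ 1 →
      (1 - t) * dist (γ 0) (γ 1) ^ 2 ≤ dist p (γ 1) ^ 2 - dist p (γ 0) ^ 2 := by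
    intro t ht0 ht1
    have hmin : dist p (γ 0) ≤ dist p (γ t) :=
      hq ▸ Metric.infDist_le_dist_of_mem (hconv γ hγ hqY hy t ⟨ht0.le, ht1⟩)
    have hsq : dist p (γ 0) ^ 2 ≤ dist p (γ t) ^ 2 := by gcongr
    have hcat := hX.2 p γ hγ t ⟨ht0.le, ht1⟩
    refine le_of_mul_le_mul_left ?_ ht0
    linarith
  have hlim : Tendsto (fun t : ℝ => (1 - t) * dist (γ 0) (γ 1) ^ 2) (nhdsWithin 0 (Set.Ioi 0))
      (nhds ((1 - 0) * dist (γ 0) (γ 1) ^ 2)) :=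
    ((by fun_prop : Continuous fun t : ℝ => (1 - t) * dist (γ 0) (γ 1) ^ 2).tendsto
      0).mono_left nhdsWithin_le_nhds
  have hle := le_of_tendsto hlim (by
    filter_upwards [Ioc_mem_nhdsGT (zero_lt_one' ℝ)] with t ht using key t ht.1 ht.2)
  linarith

/-- If the footpoint `q` of `p` in `Y` is compared with a point `z` that is within `ε` of `Y`,
then `dist q z` is controlled by the distances from `p`. -/
theorem Cat0.sq_dist_sub_le {X : Type*} [MetricSpace X] (hX : Cat0 X) {Y : Set X}
    (hconv : GeoConvex Y) {p q z : X} {ε : ℝ} (hqY : q ∈ Y) (hq : dist p q = Metric.infDist p Y)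
    (hz : Metric.infDist z Y < ε) (hε : ε ≤ dist q z) :
    (dist q z - ε) ^ 2 ≤ (dist p z + ε) ^ 2 - dist p q ^ 2 := by
  obtain ⟨y, hy, hzy⟩ := (Metric.infDist_lt_iff ⟨q, hqY⟩).1 hz
  have hproj := hX.sq_dist_add_sq_dist_le hconv hqY hq hy
  have hqy : dist q z - ε ≤ dist q y := by
    linarith [dist_triangle q y z, dist_comm y z]
  have hpy : dist p y ≤ dist p z + ε := by linarith [dist_triangle p z y]
  have h₁ : (dist q z - ε) ^ 2 ≤ dist q y ^ 2 := pow_le_pow_left₀ (by linarith) hqy 2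
  have h₂ : dist p y ^ 2 ≤ (dist p z + ε) ^ 2 := pow_le_pow_left₀ dist_nonneg hpy 2
  linarith

theorem stmt13 {X : Type*} [MetricSpace X] [CompleteSpace X] (hX : Cat0 X)
    (Y Y' : Set X) (hne : Y.Nonempty) (hne' : Y'.Nonempty)
    (hcl : IsClosed Y) (hcl' : IsClosed Y')
    (hconv : GeoConvex Y) (hconv' : GeoConvex Y')
    (δ R : ℝ) (hδ : 0 < δ) (hδR : δ ≤ R) (hR : 0 < R)
    (hYY' : ∀ x ∈ Y, Metric.infDist x Y' ≤ δ)
    (hY'Y : ∀ x ∈ Y', Metric.infDist x Y ≤ δ)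
    (p q q' : X) (hqY : q ∈ Y) (hq : dist p q = Metric.infDist p Y)
    (hq'Y : q' ∈ Y') (hq' : dist p q' = Metric.infDist p Y')
    (hpq : dist p q ≤ 2 * R) :
    dist q q' ≤ 5 * Real.sqrt R * Real.sqrt δ := by
  set s := Real.sqrt R * Real.sqrt δ with hs
  have hs_sq : s ^ 2 = R * δ := by
    rw [hs, mul_pow, Real.sq_sqrt hR.le, Real.sq_sqrt hδ.le]
  have hs_nonneg : 0 ≤ s := by positivity
  have hδs : δ ≤ s := abs_le_of_sq_le_sq' (by nlinarith) hs_nonneg |>.2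
  rw [mul_assoc, ← hs]
  by_contra! hlt
  have hε : 5 / 4 * δ ≤ dist q q' := by linarith
  have h₁ := hX.sq_dist_sub_le hconv hqY hq
    (lt_of_le_of_lt (hY'Y q' hq'Y) (by linarith : δ < 5 / 4 * δ)) hε
  have h₂ := hX.sq_dist_sub_le hconv' hq'Y hq'
    (lt_of_le_of_lt (hYY' q hqY) (by linarith : δ < 5 / 4 * δ)) (by rwa [dist_comm])
  rw [dist_comm q' q] at h₂
  have hpq' : dist p q' ≤ dist p q + 5 / 4 * δ := by
    refine abs_le_of_sq_le_sq' ?_ (by positivity) |>.2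
    linarith [sq_nonneg (dist q q' - 5 / 4 * δ)]
  have hlow : (15 / 4 * s) ^ 2 ≤ (dist q q' - 5 / 4 * δ) ^ 2 :=
    pow_le_pow_left₀ (by positivity) (by linarith) 2
  have hup : (dist q q' - 5 / 4 * δ) ^ 2 ≤ 5 / 4 * δ * (dist p q + dist p q' + 5 / 4 * δ) := by
    linarith
  have hbound : 5 / 4 * δ * (dist p q + dist p q' + 5 / 4 * δ) ≤ 5 / 4 * δ * (13 / 2 * R) := by
    gcongr
    linarith
  nlinarith [mul_pos hR hδ]
end
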